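/- For every integer n ≥ 3 there exist a Ważewski dendrite X of order n and a finitely generated subgroup G of Homeo(X), dense in Homeo(X), such that the commutator subgroup [G,G] acts transitively on the set of branch points of X and, moreover, acts transitively on the set of branches of X: for all branch points p, q of X, every connected component B of X \ {p} and every connected component B' of X \ {q}, there exists h ∈ [G,G] with h(B) = B'. -/

import Mathlib

open Topology

/-- The set of connected components of a subset `S` of `X`. -/
def setComponents (X : Type*) [TopologicalSpace X] (S : Set X) : Set (Set X) :=
  {C | ∃ x ∈ S, C = connectedComponentIn S x}

/-- The order of a point `p` of `X`: the number of connected components of `X \ {p}`. -/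
noncomputable def ptOrder (X : Type*) [TopologicalSpace X] (p : X) : ℕ :=
  (setComponents X {p}ᶜ).ncard

/-- A dendrite: a nonempty, compact, connected, locally connected metrizable space
containing no subspace homeomorphic to the circle. -/
def IsDendrite (X : Type*) [TopologicalSpace X] : Prop :=
  Nonempty X ∧ CompactSpace X ∧ ConnectedSpace X ∧ LocallyConnectedSpace X ∧
    TopologicalSpace.MetrizableSpace X ∧
    ∀ S : Set X, IsEmpty (S ≃ₜ Circle)

/-- A Ważewski dendrite of order `n`: a dendrite all of whose points have order `1`, `2`
or `n`, and every arc (subspace homeomorphic to `[0,1]`) contains a point of order `n`. -/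
def IsWazewskiDendrite (n : ℕ) (X : Type*) [TopologicalSpace X] : Prop :=
  IsDendrite X ∧
  (∀ p : X, ptOrder X p = 1 ∨ ptOrder X p = 2 ∨ ptOrder X p = n) ∧
  ∀ A : Set X, Nonempty (A ≃ₜ unitInterval) → ∃ p ∈ A, ptOrder X p = n

/-- The group structure on self-homeomorphisms of `X`, with composition as product. -/
instance Homeomorph.instGroupSelf (X : Type*) [TopologicalSpace X] : Group (X ≃ₜ X) where
  mul f g := g.trans f
  one := Homeomorph.refl X
  inv := Homeomorph.symm
  mul_assoc _ _ _ := rfl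
  one_mul _ := Homeomorph.ext fun _ => rfl
  mul_one _ := Homeomorph.ext fun _ => rfl
  inv_mul_cancel := Homeomorph.self_trans_symm

/-- The compact-open topology on the group of self-homeomorphisms of `X` (for compact
metric `X`, this is the topology of uniform convergence). -/
instance Homeomorph.instTopSelf (X : Type*) [TopologicalSpace X] :
    TopologicalSpace (X ≃ₜ X) :=
  TopologicalSpace.induced (fun h : X ≃ₜ X => (h : C(X, X))) ContinuousMap.compactOpen

namespace Waz

open Set Filter

/-- Infinite words. -/
abbrev Sq (m : ℕ) := ℕ → Fin (m + 3)

variable {m : ℕ}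

def cns (a : Fin (m + 3)) (s : Sq m) : Sq m
  | 0 => a
  | k + 1 => s k

def tl (s : Sq m) : Sq m := fun k => s (k + 1)

@[simp] theorem cns_zero (a : Fin (m + 3)) (s : Sq m) : cns a s 0 = a := rfl
@[simp] theorem cns_succ (a : Fin (m + 3)) (s : Sq m) (k : ℕ) : cns a s (k + 1) = s k := rfl
@[simp] theorem tl_cns (a : Fin (m + 3)) (s : Sq m) : tl (cns a s) = s := rfl
theorem cns_tl (s : Sq m) : cns (s 0) (tl s) = s := by
  funext k; cases k <;> rfl

theorem cns_inj {a b : Fin (m + 3)} {s t : Sq m} (h : cns a s = cns b t) : a = b ∧ s = t :=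
  ⟨congrFun h 0, by simpa using congrArg tl h⟩

def w1 : Sq m := fun _ => 1
def w0 : Sq m := cns 0 w1

theorem cns_one_w1 : cns 1 w1 = (w1 : Sq m) := by
  funext k; cases k <;> rfl

def app : List (Fin (m + 3)) → Sq m → Sq m
  | [], s => s
  | a :: w, s => cns a (app w s)

theorem w1_ne (w : List (Fin (m + 3))) : app w w0 ≠ (w1 : Sq m) := by
  induction w with
  | nil => intro h; have := congrFun h 0; simp [app, w0, w1] at this
  | cons a w ih =>
    intro h
    apply ih
    exact congrArg tl h

theorem w0_ne (w : List (Fin (m + 3))) (a : Fin (m + 3)) : app w (cns a w0) ≠ (w0 : Sq m) := by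
  intro h
  cases w with
  | nil =>
    have := congrArg tl h
    exact w1_ne [] (by simpa [app, w0] using this)
  | cons b w =>
    have := congrArg tl h
    simp only [app, tl_cns, w0] at this
    have h2 : app (w ++ [a]) w0 = (w1 : Sq m) := by
      rw [← this]
      clear this h
      induction w with
      | nil => rfl
      | cons c w ih => simp only [List.cons_append, app, ih]
    exact w1_ne _ h2

theorem app_inj : ∀ (w v : List (Fin (m + 3))) (a b : Fin (m + 3)),
    app w (cns a w0) = app v (cns b w0) → w = v
  | [], [], _, _, _ => rfl
  | [], c :: v, a, b, h => absurd (cns_inj h).2.symm (w0_ne v b)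
  | c :: w, [], a, b, h => absurd (cns_inj h).2 (w0_ne w a)
  | c :: w, d :: v, a, b, h => by
    obtain ⟨h1, h2⟩ := cns_inj h
    rw [h1, app_inj w v a b h2]

def Rl (s t : Sq m) : Prop :=
  s = t ∨ ∃ w a b, s = app w (cns a w0) ∧ t = app w (cns b w0)

def stp (m : ℕ) : Setoid (Sq m) where
  r := Rl
  iseqv := by
    refine ⟨fun s => Or.inl rfl, ?_, ?_⟩
    · rintro s t (h | ⟨w, a, b, h1, h2⟩)
      · exact Or.inl h.symm
      · exact Or.inr ⟨w, b, a, h2, h1⟩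
    · rintro s t u (rfl | ⟨w, a, b, h1, h2⟩) (rfl | ⟨w', a', b', h1', h2'⟩)
      · exact Or.inl rfl
      · exact Or.inr ⟨_, _, _, h1', h2'⟩
      · exact Or.inr ⟨_, _, _, h1, h2⟩
      · have := app_inj _ _ _ _ (h2.symm.trans h1')
        subst this
        have hlast := h2'
        exact Or.inr ⟨_, _, _, h1, hlast⟩

/-- The dendrite. -/
def D (m : ℕ) : Type := Quotient (stp m)

instance : TopologicalSpace (D m) := inferInstanceAs (TopologicalSpace (Quotient (stp m)))

def pr (s : Sq m) : D m := Quotient.mk (stp m) s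

theorem pr_surj : Function.Surjective (pr : Sq m → D m) := Quotient.mk_surjective
theorem pr_quot : IsQuotientMap (pr : Sq m → D m) := isQuotientMap_quot_mk
theorem pr_cont : Continuous (pr : Sq m → D m) := pr_quot.continuous
theorem pr_eq {s t : Sq m} : pr s = pr t ↔ Rl s t := Quotient.eq (r := stp m)

theorem Rl_cns {s t : Sq m} (a : Fin (m + 3)) (h : Rl s t) : Rl (cns a s) (cns a t) := by
  rcases h with rfl | ⟨w, b, b', rfl, rfl⟩
  · exact Or.inl rfl
  · exact Or.inr ⟨a :: w, b, b', rfl, rfl⟩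

def c (a : Fin (m + 3)) (x : D m) : D m :=
  Quotient.liftOn (s := stp m) x (fun s => pr (cns a s)) (fun _ _ h => pr_eq.2 (Rl_cns a h))

theorem c_pr (a : Fin (m + 3)) (s : Sq m) : c a (pr s) = pr (cns a s) := rfl

def E0 : D m := pr w0
def E1 : D m := pr w1
def rt : D m := c 0 E0

theorem c0E1 : c 0 E1 = (E0 : D m) := rfl
theorem c1E1 : c 1 E1 = (E1 : D m) := by
  show pr (cns 1 w1) = pr w1
  rw [cns_one_w1]

theorem c_E0 (a b : Fin (m + 3)) : c a E0 = (c b E0 : D m) :=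
  pr_eq.2 (Or.inr ⟨[], a, b, rfl, rfl⟩)

theorem c_E0' (a : Fin (m + 3)) : c a E0 = (rt : D m) := c_E0 a 0

theorem pr_eq_E0 {s : Sq m} (h : pr s = E0) : s = w0 := by
  rcases pr_eq.1 h with rfl | ⟨w, a, b, h1, h2⟩
  · rfl
  · exact absurd h2.symm (w0_ne w b)

theorem exists_c (x : D m) : ∃ a y, x = c a y := by
  obtain ⟨s, rfl⟩ := pr_surj x
  exact ⟨s 0, pr (tl s), by rw [c_pr, cns_tl]⟩

theorem c_eq {a b : Fin (m + 3)} {x y : D m} :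
    c a x = c b y ↔ (a = b ∧ x = y) ∨ (x = E0 ∧ y = E0) := by
  constructor
  · intro h
    obtain ⟨s, rfl⟩ := pr_surj x
    obtain ⟨t, rfl⟩ := pr_surj y
    rw [c_pr, c_pr, pr_eq] at h
    rcases h with h | ⟨w, a', b', h1, h2⟩
    · obtain ⟨rfl, rfl⟩ := cns_inj h
      exact Or.inl ⟨rfl, rfl⟩
    · cases w with
      | nil =>
        right
        rw [(cns_inj h1).2, (cns_inj h2).2]
        exact ⟨rfl, rfl⟩
      | cons d w =>
        left
        obtain ⟨rfl, rfl⟩ := cns_inj h1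
        obtain ⟨rfl, rfl⟩ := cns_inj h2
        exact ⟨rfl, pr_eq.2 (Or.inr ⟨w, a', b', rfl, rfl⟩)⟩
  · rintro (⟨rfl, rfl⟩ | ⟨rfl, rfl⟩)
    · rfl
    · exact c_E0 _ _

theorem c_inj (a : Fin (m + 3)) : Function.Injective (c a : D m → D m) := by
  intro x y h
  rcases c_eq.1 h with h | h
  · exact h.2
  · rw [h.1, h.2]

theorem c_eq_rt {a : Fin (m + 3)} {x : D m} : c a x = rt ↔ x = E0 := by
  rw [rt, c_eq]
  constructor
  · rintro (h | h)
    · exact h.2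
    · exact h.1
  · intro h; exact Or.inr ⟨h, rfl⟩

theorem E1_ne_E0 : (E1 : D m) ≠ E0 := by
  intro h
  have := pr_eq_E0 h
  have := congrFun this 0
  simp [w0, w1] at this

theorem E0_ne_rt : (E0 : D m) ≠ rt := by
  rw [← c0E1, Ne, c_eq_rt]; exact E1_ne_E0

theorem E1_ne_rt : (E1 : D m) ≠ rt := by
  rw [← c1E1, Ne, c_eq_rt]; exact E1_ne_E0

theorem cont_cns (a : Fin (m + 3)) : Continuous (cns a : Sq m → Sq m) := by
  refine continuous_pi fun k => ?_
  cases k with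
  | zero => exact continuous_const
  | succ k => exact continuous_apply k

theorem cont_tl : Continuous (tl : Sq m → Sq m) :=
  continuous_pi fun k => continuous_apply (k + 1)

theorem c_cont (a : Fin (m + 3)) : Continuous (c a : D m → D m) :=
  pr_quot.continuous_iff.2 (pr_cont.comp (cont_cns a))

theorem isOpen_iff_c {S : Set (D m)} : IsOpen S ↔ ∀ a, IsOpen (c a ⁻¹' S) := by
  constructor
  · intro h a; exact h.preimage (c_cont a)
  · intro h
    rw [← pr_quot.isOpen_preimage]
    have : pr ⁻¹' S = ⋃ a, ({s : Sq m | s 0 = a} ∩ tl ⁻¹' (pr ⁻¹' (c a ⁻¹' S))) := by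
      ext s
      simp only [mem_preimage, mem_iUnion, mem_inter_iff, mem_ofPred_eq]
      constructor
      · intro hs
        exact ⟨s 0, rfl, by rw [c_pr, cns_tl]; exact hs⟩
      · rintro ⟨a, rfl, hs⟩
        rw [c_pr, cns_tl] at hs; exact hs
    rw [this]
    refine isOpen_iUnion fun a => IsOpen.inter ?_ (((h a).preimage pr_cont).preimage cont_tl)
    exact (isOpen_discrete ({a} : Set (Fin (m + 3)))).preimage
      (continuous_apply (A := fun _ : ℕ => Fin (m + 3)) 0)

theorem continuous_iff_c {Y : Type*} [TopologicalSpace Y] {f : D m → Y} :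
    Continuous f ↔ ∀ a, Continuous (fun x => f (c a x)) := by
  constructor
  · intro h a; exact h.comp (c_cont a)
  · intro h
    refine ⟨fun S hS => isOpen_iff_c.2 fun a => ?_⟩
    exact hS.preimage (h a)

instance : CompactSpace (D m) := inferInstanceAs (CompactSpace (Quotient (stp m)))
instance : Nonempty (D m) := ⟨rt⟩

/-- Gluing maps along the wedge decomposition. -/
def glue {Y : Type*} (f : Fin (m + 3) → D m → Y) (h : ∀ a b, f a E0 = f b E0) (x : D m) : Y :=
  Quotient.liftOn (s := stp m) x (fun s => f (s 0) (pr (tl s))) (by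
    rintro s t (rfl | ⟨w, a, b, rfl, rfl⟩)
    · rfl
    · cases w with
      | nil => exact h a b
      | cons d w =>
        show f d (pr (app w _)) = f d (pr (app w _))
        rw [pr_eq.2 (Or.inr ⟨w, a, b, rfl, rfl⟩)])

@[simp] theorem glue_c {Y : Type*} (f : Fin (m + 3) → D m → Y) (h : ∀ a b, f a E0 = f b E0)
    (a : Fin (m + 3)) (x : D m) : glue f h (c a x) = f a x := by
  obtain ⟨s, rfl⟩ := pr_surj x
  rfl

theorem glue_cont {Y : Type*} [TopologicalSpace Y] (f : Fin (m + 3) → D m → Y)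
    (h : ∀ a b, f a E0 = f b E0) (hf : ∀ a, Continuous (f a)) : Continuous (glue f h) := by
  rw [continuous_iff_c]
  intro a
  simpa using hf a

theorem ext_c {Y : Type*} {f g : D m → Y} (h : ∀ a x, f (c a x) = g (c a x)) (x : D m) :
    f x = g x := by
  obtain ⟨a, y, rfl⟩ := exists_c x
  exact h a y

/-! ### Separation -/

def Sep (p x y : D m) : Prop :=
  ∃ U V : Set (D m), IsOpen U ∧ IsOpen V ∧ Disjoint U V ∧ U ∪ V = {p}ᶜ ∧ x ∈ U ∧ y ∈ V

theorem Sep.symm {p x y : D m} (h : Sep p x y) : Sep p y x := by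
  obtain ⟨U, V, h1, h2, h3, h4, h5, h6⟩ := h
  exact ⟨V, U, h2, h1, h3.symm, by rw [union_comm, h4], h6, h5⟩

inductive Br : D m → Prop
  | root : Br rt
  | cons (a : Fin (m + 3)) (p : D m) : Br p → Br (c a p)

theorem Br.ne : ∀ {p : D m}, Br p → p ≠ E0 ∧ p ≠ E1 := by
  intro p h
  induction h with
  | root => exact ⟨E0_ne_rt.symm, E1_ne_rt.symm⟩
  | cons a p hp ih =>
    constructor
    · rw [← c0E1]; intro h
      rcases c_eq.1 h with h | h
      · exact ih.2 h.2
      · exact ih.1 h.1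
    · intro h
      rw [← c1E1] at h
      rcases c_eq.1 h with h | h
      · exact ih.2 h.2
      · exact ih.1 h.1

theorem Sep.cons {p x y : D m} (h : Sep p x y) (hp : p ≠ E0) (a : Fin (m + 3)) :
    Sep (c a p) (c a x) (c a y) := by
  wlog hE : ∃ U V : Set (D m), IsOpen U ∧ IsOpen V ∧ Disjoint U V ∧ U ∪ V = {p}ᶜ ∧ x ∈ U ∧ y ∈ V
    ∧ E0 ∈ U generalizing x y
  · refine (this h.symm ?_).symm
    obtain ⟨U, V, h1, h2, h3, h4, h5, h6⟩ := h
    refine ⟨V, U, h2, h1, h3.symm, by rw [union_comm, h4], h6, h5, ?_⟩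
    have : E0 ∈ U ∪ V := by rw [h4]; exact hp.symm
    rcases this with h | h
    · exact absurd ⟨U, V, h1, h2, h3, h4, h5, h6, h⟩ hE
    · exact h
  obtain ⟨U, V, h1, h2, h3, h4, h5, h6, h7⟩ := hE
  have hV : E0 ∉ V := fun h => disjoint_left.1 h3 h7 h
  have hpU : p ∉ U := fun h => by
    have : p ∈ U ∪ V := Or.inl h
    rw [h4] at this; exact this rfl
  have hpV : p ∉ V := fun h => by
    have : p ∈ U ∪ V := Or.inr h
    rw [h4] at this; exact this rfl
  have hpc : ∀ b z, c b z = c a p ↔ b = a ∧ z = p := by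
    intro b z
    rw [c_eq]
    constructor
    · rintro (h | h)
      · exact h
      · exact absurd h.2 hp
    · exact Or.inl
  have hVc : ∀ b z, c b z ∈ c a '' V ↔ b = a ∧ z ∈ V := by
    intro b z
    constructor
    · rintro ⟨v, hv, hvz⟩
      rcases c_eq.1 hvz with h | h
      · exact ⟨h.1.symm, h.2 ▸ hv⟩
      · exact absurd (h.1 ▸ hv) hV
    · rintro ⟨rfl, h⟩; exact ⟨z, h, rfl⟩
  refine ⟨(c a '' V ∪ {c a p})ᶜ, c a '' V, ?_, ?_, ?_, ?_, ?_, ⟨y, h6, rfl⟩⟩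
  · rw [isOpen_iff_c]
    intro b
    by_cases hb : b = a
    · subst hb
      convert h1 using 1
      ext z
      simp only [mem_preimage, mem_compl_iff, mem_union, hVc, mem_singleton_iff, hpc, true_and]
      have := Set.ext_iff.1 h4 z
      have h3' : z ∈ U → z ∉ V := fun h => disjoint_left.1 h3 h
      simp only [mem_union, mem_compl_iff, mem_singleton_iff] at this
      tauto
    · convert isOpen_univ using 1
      ext z
      simp only [mem_preimage, mem_compl_iff, mem_union, hVc, mem_singleton_iff, hpc, hb]
      simp
  · rw [isOpen_iff_c]
    intro b
    by_cases hb : b = a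
    · subst hb
      convert h2 using 1
      ext z
      simp [hVc]
    · convert isOpen_empty using 1
      ext z
      simp [hVc, hb]
  · rw [disjoint_left]
    intro z hz hz'
    exact hz (Or.inl hz')
  · ext z
    simp only [mem_union, mem_compl_iff, mem_singleton_iff]
    constructor
    · rintro (h | h) h'
      · exact h (Or.inr h')
      · subst h'
        rw [hVc] at h
        exact hpV h.2
    · intro h
      by_cases h' : z ∈ c a '' V
      · exact Or.inr h'
      · left; rintro (h'' | h'')
        · exact h' h''
        · exact h h''
  · simp only [mem_union, mem_compl_iff, hVc, mem_singleton_iff, hpc, true_and]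
    rintro (h | h)
    · exact disjoint_left.1 h3 h5 h
    · exact hpU (h ▸ h5)

/-- The open branches at the root. -/
def Ub (a : Fin (m + 3)) : Set (D m) := c a '' {E0}ᶜ

theorem c_mem_Ub {a b : Fin (m + 3)} {x : D m} : c b x ∈ Ub a ↔ b = a ∧ x ≠ E0 := by
  constructor
  · rintro ⟨y, hy, h⟩
    rcases c_eq.1 h with h | h
    · exact ⟨h.1.symm, h.2 ▸ hy⟩
    · exact absurd h.1 hy
  · rintro ⟨rfl, h⟩; exact ⟨x, h, rfl⟩

theorem isClosed_E0 : IsClosed ({E0} : Set (D m)) := by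
  rw [← pr_quot.isClosed_preimage]
  convert isClosed_singleton (x := (w0 : Sq m)) using 1
  ext s
  exact ⟨fun h => pr_eq_E0 h, fun h => congrArg pr h⟩

theorem Ub_open (a : Fin (m + 3)) : IsOpen (Ub a : Set (D m)) := by
  rw [isOpen_iff_c]
  intro b
  by_cases hb : b = a
  · subst hb
    convert isClosed_E0.isOpen_compl using 1
    ext z; simp [c_mem_Ub]
  · convert isOpen_empty using 1
    ext z; simp [c_mem_Ub, hb]

theorem mem_Ub_of_ne {x : D m} (h : x ≠ rt) : ∃ a, x ∈ Ub a := by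
  obtain ⟨a, y, rfl⟩ := exists_c x
  exact ⟨a, c_mem_Ub.2 ⟨rfl, fun h' => h (c_eq_rt.2 h')⟩⟩

theorem Ub_disj {a b : Fin (m + 3)} {x : D m} (h : x ∈ Ub a) (h' : x ∈ Ub b) : a = b := by
  obtain ⟨d, y, rfl⟩ := exists_c x
  rw [c_mem_Ub] at h h'
  exact h.1.symm.trans h'.1

theorem rt_not_mem_Ub {a : Fin (m + 3)} : (rt : D m) ∉ Ub a := by
  rw [rt, c_mem_Ub]; simp

theorem sep_root {a b : Fin (m + 3)} {x y : D m} (hab : a ≠ b) (hx : x ≠ E0) (hy : y ≠ E0) :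
    Sep rt (c a x) (c b y) := by
  refine ⟨Ub a, ⋃ d ∈ {d | d ≠ a}, Ub d, Ub_open a, isOpen_biUnion fun d _ => Ub_open d, ?_, ?_,
    c_mem_Ub.2 ⟨rfl, hx⟩, ?_⟩
  · rw [disjoint_left]
    intro z hz hz'
    simp only [mem_iUnion] at hz'
    obtain ⟨d, hd, hz'⟩ := hz'
    exact hd (Ub_disj hz' hz)
  · ext z
    constructor
    · rintro (h | h) h'
      · exact rt_not_mem_Ub (h' ▸ h)
      · simp only [mem_iUnion] at h
        obtain ⟨d, hd, h⟩ := h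
        exact rt_not_mem_Ub (h' ▸ h)
    · intro h
      obtain ⟨d, hd⟩ := mem_Ub_of_ne h
      by_cases hda : d = a
      · left; exact hda ▸ hd
      · right; simp only [mem_iUnion]; exact ⟨d, hda, hd⟩
  · simp only [mem_iUnion]
    exact ⟨b, hab.symm, c_mem_Ub.2 ⟨rfl, hy⟩⟩

theorem sep_E0_E1 : Sep (rt : D m) E0 E1 := by
  have := sep_root (m := m) (a := 0) (b := 1) (by simp) E1_ne_E0 E1_ne_E0
  rwa [c0E1, c1E1] at this

theorem sep_E1 (k : ℕ) : ∀ s : Sq m, s k ≠ 1 → ∃ p, Br p ∧ Sep p E1 (pr s) := by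
  induction k with
  | zero =>
    intro s hs
    by_cases h : pr (tl s) = E0
    · refine ⟨c 1 rt, Br.root.cons _ _, ?_⟩
      have : pr s = c 1 E0 := by
        rw [← cns_tl s, ← c_pr, h, c_E0]
      rw [this]
      have := (sep_E0_E1 (m := m)).symm.cons E0_ne_rt.symm 1
      rwa [c1E1] at this
    · refine ⟨rt, Br.root, ?_⟩
      rw [← cns_tl s, ← c_pr]
      have := sep_root (m := m) (a := 1) (b := s 0) hs.symm E1_ne_E0 h
      rwa [c1E1] at this
  | succ k ih =>
    intro s hs
    by_cases h0 : s 0 = 1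
    · obtain ⟨p, hp, h⟩ := ih (tl s) hs
      refine ⟨c 1 p, hp.cons _ _, ?_⟩
      rw [← cns_tl s, ← c_pr, h0]
      have := h.cons hp.ne.1 1
      rwa [c1E1] at this
    · by_cases h : pr (tl s) = E0
      · refine ⟨c 1 rt, Br.root.cons _ _, ?_⟩
        have : pr s = c 1 E0 := by
          rw [← cns_tl s, ← c_pr, h, c_E0]
        rw [this]
        have := (sep_E0_E1 (m := m)).symm.cons E0_ne_rt.symm 1
        rwa [c1E1] at this
      · refine ⟨rt, Br.root, ?_⟩
        rw [← cns_tl s, ← c_pr]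
        have := sep_root (m := m) (a := 1) (b := s 0) (Ne.symm h0) E1_ne_E0 h
        rwa [c1E1] at this

theorem sep_E1' {x : D m} (h : x ≠ E1) : ∃ p, Br p ∧ Sep p E1 x := by
  obtain ⟨s, rfl⟩ := pr_surj x
  by_contra! hc
  apply h
  have : s = w1 := by
    funext k
    by_contra hk
    obtain ⟨p, hp, h⟩ := sep_E1 k s hk
    exact hc p hp h
  rw [this]; rfl

theorem sep_E0' {x : D m} (h : x ≠ E0) : ∃ p, Br p ∧ Sep p E0 x := by
  obtain ⟨a, y, rfl⟩ := exists_c x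
  by_cases hy : y = E0
  · subst hy
    refine ⟨c 0 rt, Br.root.cons _ _, ?_⟩
    have := (sep_E0_E1 (m := m)).symm.cons E0_ne_rt.symm 0
    rwa [c0E1, c_E0 0 a] at this
  by_cases ha : a = 0
  · subst ha
    have : y ≠ E1 := by rintro rfl; exact h c0E1
    obtain ⟨p, hp, h⟩ := sep_E1' this
    refine ⟨c 0 p, hp.cons _ _, ?_⟩
    have := h.cons hp.ne.1 0
    rwa [c0E1] at this
  · refine ⟨rt, Br.root, ?_⟩
    have := sep_root (m := m) (Ne.symm ha) E1_ne_E0 hy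
    rwa [c0E1] at this

theorem sep_aux (k : ℕ) : ∀ s t : Sq m, s k ≠ t k → pr s ≠ pr t →
    ∃ p, Br p ∧ Sep p (pr s) (pr t) := by
  induction k with
  | zero =>
    intro s t h hst
    rw [← cns_tl s, ← cns_tl t, ← c_pr, ← c_pr] at hst ⊢
    by_cases h1 : pr (tl s) = E0
    · rw [h1, c_E0 _ (t 0)] at hst ⊢
      have : pr (tl t) ≠ E0 := fun h => hst (by rw [h])
      obtain ⟨p, hp, h⟩ := sep_E0' this
      exact ⟨_, hp.cons _ _, h.cons hp.ne.1 _⟩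
    · by_cases h2 : pr (tl t) = E0
      · rw [h2, c_E0 _ (s 0)] at hst ⊢
        obtain ⟨p, hp, h⟩ := sep_E0' h1
        exact ⟨_, hp.cons _ _, h.symm.cons hp.ne.1 _⟩
      · exact ⟨rt, Br.root, sep_root h h1 h2⟩
  | succ k ih =>
    intro s t h hst
    by_cases h0 : s 0 = t 0
    · rw [← cns_tl s, ← cns_tl t, ← c_pr, ← c_pr, h0] at hst ⊢
      have : pr (tl s) ≠ pr (tl t) := fun h => hst (by rw [h])
      obtain ⟨p, hp, h⟩ := ih _ _ h this
      exact ⟨_, hp.cons _ _, h.cons hp.ne.1 _⟩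
    · rw [← cns_tl s, ← cns_tl t, ← c_pr, ← c_pr] at hst ⊢
      by_cases h1 : pr (tl s) = E0
      · rw [h1, c_E0 _ (t 0)] at hst ⊢
        have : pr (tl t) ≠ E0 := fun h => hst (by rw [h])
        obtain ⟨p, hp, h⟩ := sep_E0' this
        exact ⟨_, hp.cons _ _, h.cons hp.ne.1 _⟩
      · by_cases h2 : pr (tl t) = E0
        · rw [h2, c_E0 _ (s 0)] at hst ⊢
          obtain ⟨p, hp, h⟩ := sep_E0' h1
          exact ⟨_, hp.cons _ _, h.symm.cons hp.ne.1 _⟩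
        · exact ⟨rt, Br.root, sep_root h0 h1 h2⟩

theorem exists_sep {x y : D m} (h : x ≠ y) : ∃ p, Br p ∧ Sep p x y := by
  obtain ⟨s, rfl⟩ := pr_surj x
  obtain ⟨t, rfl⟩ := pr_surj y
  have : s ≠ t := fun h' => h (by rw [h'])
  obtain ⟨k, hk⟩ := Function.ne_iff.1 this
  exact sep_aux k s t hk h

instance : T2Space (D m) := ⟨fun x y h => by
  obtain ⟨p, -, U, V, h1, h2, h3, -, h5, h6⟩ := exists_sep h
  exact ⟨U, V, h1, h2, h5, h6, h3⟩⟩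

theorem Sep.not_conn {p x y : D m} (h : Sep p x y) {C : Set (D m)} (hC : IsPreconnected C)
    (hp : p ∉ C) (hx : x ∈ C) (hy : y ∈ C) : False := by
  obtain ⟨U, V, h1, h2, h3, h4, h5, h6⟩ := h
  obtain ⟨z, hz, hz'⟩ := hC U V h1 h2 (by rw [h4]; intro z hz h'; exact hp (h' ▸ hz))
    ⟨x, hx, h5⟩ ⟨y, hy, h6⟩
  exact disjoint_left.1 h3 hz'.1 hz'.2

theorem Sep.of_cons {p x y : D m} {a : Fin (m + 3)} (h : Sep (c a p) (c a x) (c a y)) :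
    Sep p x y := by
  obtain ⟨U, V, h1, h2, h3, h4, h5, h6⟩ := h
  refine ⟨c a ⁻¹' U, c a ⁻¹' V, h1.preimage (c_cont a), h2.preimage (c_cont a),
    h3.preimage _, ?_, h5, h6⟩
  rw [← preimage_union, h4]
  ext z
  simp [(c_inj a).eq_iff]

end Waz
namespace Waz

open Set Filter

variable {m : ℕ}

def cw : List (Fin (m + 3)) → D m → D m
  | [], x => x
  | a :: w, x => c a (cw w x)

theorem cw_cont (w : List (Fin (m + 3))) : Continuous (cw w : D m → D m) := by
  induction w with
  | nil => exact continuous_id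
  | cons a w ih => exact (c_cont a).comp ih

theorem cw_pr (w : List (Fin (m + 3))) (s : Sq m) : cw w (pr s) = pr (app w s) := by
  induction w with
  | nil => rfl
  | cons a w ih => simp only [cw, app, ih, c_pr]

theorem app_agree (w : List (Fin (m + 3))) (s t : Sq m) : ∀ i < w.length, app w s i = app w t i := by
  induction w with
  | nil => intro i hi; simp at hi
  | cons a w ih =>
    intro i hi
    cases i with
    | zero => rfl
    | succ i => exact ih i (by simpa using hi)

theorem cyl_of_open {S : Set (Sq m)} (hS : IsOpen S) {s : Sq m} (hs : s ∈ S) :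
    ∃ k : ℕ, ∀ t : Sq m, (∀ i < k, t i = s i) → t ∈ S := by
  obtain ⟨I, u, h1, h2⟩ := isOpen_pi_iff.1 hS s hs
  refine ⟨I.sup id + 1, fun t ht => h2 ?_⟩
  intro i hi
  rw [ht i (Nat.lt_succ_of_le (Finset.le_sup (f := id) hi))]
  exact (h1 i hi).2

theorem cyl_nhds (s : Sq m) (k : ℕ) : {t : Sq m | ∀ i < k, t i = s i} ∈ 𝓝 s := by
  have : {t : Sq m | ∀ i < k, t i = s i} = ⋂ i ∈ Finset.range k, {t : Sq m | t i = s i} := by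
    ext t; simp
  rw [this, Finset.iInter_mem_sets]
  intro i _
  exact ((isOpen_discrete ({s i} : Set (Fin (m + 3)))).preimage
      (continuous_apply (A := fun _ : ℕ => Fin (m + 3)) i)).mem_nhds rfl

theorem lebesgue {U V : Set (D m)} (hU : IsOpen U) (hV : IsOpen V) (hUV : U ∪ V = univ) :
    ∃ k : ℕ, ∀ w : List (Fin (m + 3)), k ≤ w.length → (∀ x, cw w x ∈ U) ∨ (∀ x, cw w x ∈ V) := by
  have h1 : ∀ s : Sq m, ∃ k : ℕ, (∀ t : Sq m, (∀ i < k, t i = s i) → pr t ∈ U) ∨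
      (∀ t : Sq m, (∀ i < k, t i = s i) → pr t ∈ V) := by
    intro s
    have : pr s ∈ U ∪ V := by rw [hUV]; trivial
    rcases this with h | h
    · obtain ⟨k, hk⟩ := cyl_of_open (hU.preimage pr_cont) h
      exact ⟨k, Or.inl hk⟩
    · obtain ⟨k, hk⟩ := cyl_of_open (hV.preimage pr_cont) h
      exact ⟨k, Or.inr hk⟩
  choose k hk using h1
  obtain ⟨T, -, hT⟩ := (isCompact_univ (X := Sq m)).elim_nhds_subcover
    (fun s => {t : Sq m | ∀ i < k s, t i = s i}) (fun s _ => cyl_nhds s (k s))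
  refine ⟨T.sup k, fun w hw => ?_⟩
  have := hT (mem_univ (app w w1))
  simp only [mem_iUnion] at this
  obtain ⟨s, hs, hsw⟩ := this
  have hks : k s ≤ w.length := (Finset.le_sup hs).trans hw
  rcases hk s with h | h
  · left; intro x
    obtain ⟨t, rfl⟩ := pr_surj x
    rw [cw_pr]
    exact h _ fun i hi => (app_agree w t w1 i (hi.trans_le hks)).trans (hsw i hi)
  · right; intro x
    obtain ⟨t, rfl⟩ := pr_surj x
    rw [cw_pr]
    exact h _ fun i hi => (app_agree w t w1 i (hi.trans_le hks)).trans (hsw i hi)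

theorem exists_cw (k : ℕ) : ∀ x : D m, ∃ w : List (Fin (m + 3)), w.length = k ∧ ∃ y, x = cw w y := by
  induction k with
  | zero => intro x; exact ⟨[], rfl, x, rfl⟩
  | succ k ih =>
    intro x
    obtain ⟨a, y, rfl⟩ := exists_c x
    obtain ⟨w, hw, z, rfl⟩ := ih y
    exact ⟨a :: w, by simp [hw], z, rfl⟩

theorem const_aux (k : ℕ) : ∀ f : D m → Bool,
    (∀ w : List (Fin (m + 3)), w.length = k → ∀ x y, f (cw w x) = f (cw w y)) →
    ∀ x y, f x = f y := by
  induction k with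
  | zero => intro f h; exact h [] rfl
  | succ k ih =>
    intro f h
    have key : ∀ x, f x = f rt := by
      intro x
      obtain ⟨a, y, rfl⟩ := exists_c x
      rw [← c_E0' a]
      exact ih (fun z => f (c a z)) (fun w hw x y => h (a :: w) (by simp [hw]) x y) y E0
    intro x y; rw [key x, key y]

instance : ConnectedSpace (D m) := by
  have : PreconnectedSpace (D m) := by
    apply preconnectedSpace_of_forall_constant
    intro f hf
    obtain ⟨k, hk⟩ := lebesgue (m := m) (U := f ⁻¹' {true}) (V := f ⁻¹' {false})
      ((isOpen_discrete _).preimage hf) ((isOpen_discrete _).preimage hf) (by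
        ext x; simp)
    apply const_aux k
    intro w hw x y
    rcases hk w hw.ge with h | h
    · exact (h x).trans (h y).symm
    · exact (h x).trans (h y).symm
  exact ⟨inferInstance⟩

theorem preconn_range {f : D m → D m} (hf : Continuous f) : IsPreconnected (range f) :=
  isPreconnected_range hf

theorem closed_range {f : D m → D m} (hf : Continuous f) : IsClosed (range f) :=
  (isCompact_range hf).isClosed

def coCells (T : Set (List (Fin (m + 3)))) : Set (D m) := (⋃ w ∈ T, range (cw w))ᶜ

theorem coCells_open {T : Set (List (Fin (m + 3)))} (hT : T.Finite) :
    IsOpen (coCells T : Set (D m)) :=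
  (hT.isClosed_biUnion fun w _ => closed_range (cw_cont w)).isOpen_compl

theorem nb_aux {x : D m} {U : Set (D m)} (hU : IsOpen U) (hx : x ∈ U) :
    ∃ T : Set (List (Fin (m + 3))), T.Finite ∧ x ∈ coCells T ∧
      ∃ C : Set (D m), IsPreconnected C ∧ coCells T ⊆ C ∧ C ⊆ U := by
  obtain ⟨k, hk⟩ := lebesgue (m := m) (V := {x}ᶜ) hU isOpen_compl_singleton (by
    ext y; by_cases h : y = x <;> simp [h, hx])
  refine ⟨{w | w.length = k ∧ x ∉ range (cw w)}, ?_, ?_,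
    ⋃₀ {S | ∃ w : List (Fin (m + 3)), w.length = k ∧ x ∈ range (cw w : D m → D m) ∧
      S = range (cw w)}, ?_, ?_, ?_⟩
  · exact (List.finite_length_eq (Fin (m + 3)) k).subset fun w hw => hw.1
  · simp only [coCells, mem_compl_iff, mem_iUnion, not_exists]
    intro w hw h
    exact hw.2 h
  · apply isPreconnected_sUnion x
    · rintro S ⟨w, -, h, rfl⟩; exact h
    · rintro S ⟨w, -, h, rfl⟩; exact preconn_range (cw_cont w)
  · intro y hy
    obtain ⟨w, hw, z, rfl⟩ := exists_cw k y
    refine ⟨_, ⟨w, hw, ?_, rfl⟩, ⟨z, rfl⟩⟩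
    by_contra hxw
    apply hy
    simp only [mem_iUnion]
    exact ⟨w, ⟨hw, hxw⟩, ⟨z, rfl⟩⟩
  · rintro y ⟨S, ⟨w, hw, ⟨z, hz⟩, rfl⟩, ⟨y', rfl⟩⟩
    rcases hk w hw.ge with h | h
    · exact h y'
    · exact absurd hz (h z)

instance : LocallyConnectedSpace (D m) := by
  rw [locallyConnectedSpace_iff_connected_subsets]
  intro x U hU
  obtain ⟨U', hU', ho, hx⟩ := mem_nhds_iff.1 hU
  obtain ⟨T, hT, hxT, C, hC, h1, h2⟩ := nb_aux ho hx
  exact ⟨C, mem_of_superset ((coCells_open hT).mem_nhds hxT) h1, hC, h2.trans hU'⟩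

instance : SecondCountableTopology (D m) := by
  have : TopologicalSpace.IsTopologicalBasis
      (coCells '' {T : Set (List (Fin (m + 3))) | T.Finite} : Set (Set (D m))) := by
    apply TopologicalSpace.isTopologicalBasis_of_isOpen_of_nhds
    · rintro _ ⟨T, hT, rfl⟩; exact coCells_open hT
    · intro x U hx hU
      obtain ⟨T, hT, hxT, C, hC, h1, h2⟩ := nb_aux hU hx
      exact ⟨_, ⟨T, hT, rfl⟩, hxT, h1.trans h2⟩
  have hc : {T : Set (List (Fin (m + 3))) | T.Finite}.Countable := by
    refine (Set.countable_ofPred_finite_subset (s := (univ : Set (List (Fin (m + 3)))))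
      (Set.to_countable _)).mono ?_
    intro T hT
    exact And.intro hT (subset_univ T)
  exact this.secondCountableTopology (hc.image _)

instance : TopologicalSpace.MetrizableSpace (D m) :=
  TopologicalSpace.metrizableSpace_of_t3_secondCountable _

/-! ### complements of end points and the root -/

theorem preconn_cells (s : Set (Fin (m + 3))) : IsPreconnected (⋃ a ∈ s, range (c a : D m → D m)) := by
  rw [← sUnion_image]
  apply isPreconnected_sUnion rt
  · rintro _ ⟨a, -, rfl⟩; exact ⟨E0, c_E0' a⟩
  · rintro _ ⟨a, -, rfl⟩; exact preconn_range (c_cont a)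

theorem preconn_un {M B : Set (D m)} (hM : IsPreconnected M) (hB : IsPreconnected B) (q : D m)
    (hq : q ∈ M) (h : B.Nonempty → q ∈ B) : IsPreconnected (M ∪ B) := by
  rcases B.eq_empty_or_nonempty with rfl | hne
  · simpa using hM
  · exact hM.union q hq (h hne) hB

theorem iter_c1_E1 (k : ℕ) : (c 1)^[k] E1 = (E1 : D m) :=
  Function.iterate_fixed c1E1 k

theorem preconn_E1 : IsPreconnected ({E1}ᶜ : Set (D m)) := by
  have h1 : ({E1}ᶜ : Set (D m)) =
      ⋃ k : ℕ, (c 1)^[k] '' (⋃ a ∈ ({1}ᶜ : Set (Fin (m + 3))), range (c a)) := by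
    ext x
    constructor
    · intro hx
      obtain ⟨s, rfl⟩ := pr_surj x
      have : s ≠ w1 := fun h => hx (by rw [h]; rfl)
      obtain ⟨k, hk⟩ := Function.ne_iff.1 this
      clear this hx
      induction k generalizing s with
      | zero =>
        refine mem_iUnion.2 ⟨0, ?_⟩
        simp only [Function.iterate_zero, image_id, mem_iUnion]
        exact ⟨s 0, hk, pr (tl s), by rw [c_pr, cns_tl]⟩
      | succ k ih =>
        by_cases h0 : s 0 = 1
        · obtain ⟨j, z, hz, hj⟩ := mem_iUnion.1 (ih (tl s) hk)
          refine mem_iUnion.2 ⟨j + 1, z, hz, ?_⟩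
          rw [Function.iterate_succ_apply', hj, c_pr, ← h0, cns_tl]
        · refine mem_iUnion.2 ⟨0, ?_⟩
          simp only [Function.iterate_zero, image_id, mem_iUnion]
          exact ⟨s 0, h0, pr (tl s), by rw [c_pr, cns_tl]⟩
    · rintro hx rfl
      obtain ⟨k, z, hz, hk⟩ := mem_iUnion.1 hx
      simp only [mem_iUnion] at hz
      obtain ⟨a, ha, y, rfl⟩ := hz
      rw [← iter_c1_E1 k] at hk
      have := ((c_inj 1).iterate k) hk
      rw [← c1E1] at this
      rcases c_eq.1 this with h | h
      · exact ha h.1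
      · exact E1_ne_E0 h.2
  rw [h1]
  apply IsPreconnected.iUnion_of_chain
  · intro k
    exact (preconn_cells _).image _ ((c_cont 1).iterate k).continuousOn
  · intro k
    refine ⟨(c 1)^[k] rt, ⟨rt, ?_, rfl⟩, ⟨E0, ?_, ?_⟩⟩
    · simp only [mem_iUnion]; exact ⟨0, by simp, E0, rfl⟩
    · simp only [mem_iUnion]; exact ⟨0, by simp, E1, c0E1⟩
    · show (c 1)^[k] (c 1 E0) = _
      rw [c_E0']

theorem preconn_E0 : IsPreconnected ({E0}ᶜ : Set (D m)) := by
  have : ({E0}ᶜ : Set (D m)) = (⋃ a ∈ ({0}ᶜ : Set (Fin (m + 3))), range (c a)) ∪ c 0 '' {E1}ᶜ := by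
    ext x
    constructor
    · intro hx
      obtain ⟨a, y, rfl⟩ := exists_c x
      by_cases ha : a = 0
      · subst ha
        right
        refine ⟨y, ?_, rfl⟩
        rintro rfl
        exact hx c0E1
      · left
        simp only [mem_iUnion]
        exact ⟨a, ha, y, rfl⟩
    · rintro (h | ⟨y, hy, rfl⟩) h'
      · simp only [mem_iUnion] at h
        obtain ⟨a, ha, y, rfl⟩ := h
        rw [mem_singleton_iff, ← c0E1] at h'
        rcases c_eq.1 h' with h | h
        · exact ha h.1
        · exact E1_ne_E0 h.2
      · rw [mem_singleton_iff, ← c0E1] at h'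
        exact hy (c_inj 0 h')
  rw [this]
  refine preconn_un (preconn_cells _) (preconn_E1.image _ (c_cont 0).continuousOn) rt ?_ ?_
  · simp only [mem_iUnion]; exact ⟨1, by simp, E0, c_E0' 1⟩
  · intro _; exact ⟨E0, E1_ne_E0.symm, rfl⟩

theorem preconn_Ub (a : Fin (m + 3)) : IsPreconnected (Ub a : Set (D m)) :=
  preconn_E0.image _ (c_cont a).continuousOn

theorem comp_Ub {a : Fin (m + 3)} {x : D m} (hx : x ∈ Ub a) :
    connectedComponentIn {rt}ᶜ x = Ub a := by
  apply Subset.antisymm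
  · intro z hz
    have hz' : z ≠ rt := connectedComponentIn_subset _ _ hz
    obtain ⟨b, hb⟩ := mem_Ub_of_ne hz'
    by_contra hza
    obtain ⟨y, hy, rfl⟩ := hx
    obtain ⟨y', hy', rfl⟩ := hb
    have hab : a ≠ b := by rintro rfl; exact hza ⟨y', hy', rfl⟩
    refine (sep_root hab hy hy').not_conn
      (isPreconnected_connectedComponentIn (x := c a y) (F := {rt}ᶜ)) ?_ ?_ hz
    · intro h; exact connectedComponentIn_subset _ _ h rfl
    · refine mem_connectedComponentIn ?_
      intro h; exact hy (c_eq_rt.1 h)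
  · exact (preconn_Ub a).subset_connectedComponentIn hx fun z hz h => rt_not_mem_Ub (h ▸ hz)

theorem Ub_nonempty (a : Fin (m + 3)) : (c a E1 : D m) ∈ Ub a := c_mem_Ub.2 ⟨rfl, E1_ne_E0⟩

theorem comps_rt : setComponents (D m) {rt}ᶜ = range Ub := by
  ext C
  constructor
  · rintro ⟨x, hx, rfl⟩
    obtain ⟨a, ha⟩ := mem_Ub_of_ne hx
    exact ⟨a, (comp_Ub ha).symm⟩
  · rintro ⟨a, rfl⟩
    exact ⟨c a E1, fun h => rt_not_mem_Ub (h ▸ Ub_nonempty a), (comp_Ub (Ub_nonempty a)).symm⟩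

theorem Ub_inj : Function.Injective (Ub : Fin (m + 3) → Set (D m)) := by
  intro a b h
  exact Ub_disj (Ub_nonempty a) (h ▸ Ub_nonempty a)

theorem order_rt : ptOrder (D m) rt = m + 3 := by
  rw [ptOrder, comps_rt, ← Set.image_univ, Set.ncard_image_of_injective _ Ub_inj, Set.ncard_univ]
  simp

/-! ### Points which are not branch points -/

def fk (s : Sq m) : ℕ → D m → D m
  | 0, x => x
  | k + 1, x => fk s k (c (s k) x)

theorem fk_cont (s : Sq m) (k : ℕ) : Continuous (fk s k) := by
  induction k with
  | zero => exact continuous_id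
  | succ k ih => exact ih.comp (c_cont _)

theorem fk_inj (s : Sq m) (k : ℕ) : Function.Injective (fk s k) := by
  induction k with
  | zero => exact Function.injective_id
  | succ k ih => exact ih.comp (c_inj _)

theorem fk_Br (s : Sq m) (k : ℕ) : ∀ p, Br p → Br (fk s k p) := by
  induction k with
  | zero => exact fun p h => h
  | succ k ih => exact fun p h => ih _ (h.cons _ _)

theorem fk_pr (s : Sq m) (k : ℕ) : fk s k (pr (fun i => s (k + i))) = pr s := by
  induction k with
  | zero => simp [fk]
  | succ k ih =>
    rw [fk, c_pr, ← ih]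
    congr 2
    funext i
    cases i with
    | zero => rfl
    | succ i => simp only [cns_succ]; congr 1; omega

theorem fk_cw (s : Sq m) (k : ℕ) : ∃ w : List (Fin (m + 3)), w.length = k ∧ fk s k = cw w := by
  have key : ∀ k, ∀ w, ∃ v : List (Fin (m + 3)), v.length = k + w.length ∧
      (fun x => fk s k (cw w x)) = cw v := by
    intro k
    induction k with
    | zero => intro w; exact ⟨w, by simp, rfl⟩
    | succ k ih =>
      intro w
      obtain ⟨v, hv, h⟩ := ih (s k :: w)
      exact ⟨v, by simp [hv]; omega, h⟩
  obtain ⟨v, hv, h⟩ := key k []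
  exact ⟨v, by simpa using hv, h⟩

theorem fk_range_mono (s : Sq m) {k l : ℕ} (h : k ≤ l) : range (fk s l) ⊆ range (fk s k) := by
  induction h with
  | refl => exact Subset.rfl
  | step h ih =>
    refine Subset.trans ?_ ih
    rintro _ ⟨x, rfl⟩
    exact ⟨_, rfl⟩

theorem two_sets (s : Sq m) (hs : ¬ Br (pr s)) (k : ℕ) : ∃ A B : Set (D m), IsPreconnected A ∧
    IsPreconnected B ∧ pr s ∉ A ∧ pr s ∉ B ∧ A ∪ B ∪ range (fk s k) = univ ∧
    (A.Nonempty → fk s k E0 ∈ A) ∧ (B.Nonempty → fk s k E1 ∈ B) := by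
  induction k with
  | zero =>
    refine ⟨∅, ∅, isPreconnected_empty, isPreconnected_empty, by simp, by simp, ?_, by simp, by simp⟩
    ext x; simp [fk]
  | succ k ih =>
    obtain ⟨A, B, hA, hB, hsA, hsB, hU, hA0, hB1⟩ := ih
    set M : Set (D m) := fk s k '' (⋃ a ∈ ({s k}ᶜ : Set (Fin (m + 3))), range (c a)) with hM
    have hMc : IsPreconnected M := (preconn_cells _).image _ (fk_cont s k).continuousOn
    have hMr : fk s k rt ∈ M := by
      refine ⟨rt, ?_, rfl⟩
      simp only [mem_iUnion]
      obtain ⟨b, hb⟩ := exists_ne (s k)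
      exact ⟨b, hb, E0, c_E0' b⟩
    have hMs : pr s ∉ M := by
      rintro ⟨y, hy, h⟩
      simp only [mem_iUnion] at hy
      obtain ⟨a, ha, z, rfl⟩ := hy
      rw [← fk_pr s (k + 1), fk] at h
      rcases c_eq.1 (fk_inj s k h) with h | h
      · exact ha h.1
      · apply hs
        rw [← fk_pr s (k + 1), fk, h.2, c_E0']
        exact fk_Br s k _ Br.root
    have hM0 : s k ≠ 0 → fk s k E0 ∈ M := by
      intro h
      refine ⟨E0, ?_, rfl⟩
      simp only [mem_iUnion]
      exact ⟨0, h.symm, E1, c0E1⟩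
    have hM1 : s k ≠ 1 → fk s k E1 ∈ M := by
      intro h
      refine ⟨E1, ?_, rfl⟩
      simp only [mem_iUnion]
      exact ⟨1, h.symm, E1, c1E1⟩
    have hE0 : fk s (k + 1) E0 = fk s k rt := by rw [fk, c_E0']
    have hcov : ∀ x, x ∈ A ∨ x ∈ B ∨ x ∈ M ∨ x ∈ range (fk s (k + 1)) := by
      intro x
      have : x ∈ A ∪ B ∪ range (fk s k) := by rw [hU]; trivial
      rcases this with (h | h) | ⟨y, rfl⟩
      · exact Or.inl h
      · exact Or.inr (Or.inl h)
      · right; right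
        obtain ⟨a, z, rfl⟩ := exists_c y
        by_cases ha : a = s k
        · right; exact ⟨z, by rw [fk, ha]⟩
        · left; refine ⟨_, ?_, rfl⟩
          simp only [mem_iUnion]
          exact ⟨a, ha, z, rfl⟩
    by_cases h0 : s k = 0
    · refine ⟨M ∪ B, A, preconn_un hMc hB (fk s k E1) (hM1 (by rw [h0]; simp)) hB1, hA,
        ?_, hsA, ?_, ?_, ?_⟩
      · rintro (h | h)
        · exact hMs h
        · exact hsB h
      · ext x
        have := hcov x
        simp only [mem_union, mem_univ, iff_true]
        tauto
      · intro _; left; rw [hE0]; exact hMr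
      · intro h; rw [fk, h0, c0E1]; exact hA0 h
    by_cases h1 : s k = 1
    · refine ⟨M ∪ A, B, preconn_un hMc hA (fk s k E0) (hM0 h0) hA0, hB,
        ?_, hsB, ?_, ?_, ?_⟩
      · rintro (h | h)
        · exact hMs h
        · exact hsA h
      · ext x
        have := hcov x
        simp only [mem_union, mem_univ, iff_true]
        tauto
      · intro _; left; rw [hE0]; exact hMr
      · intro h; rw [fk, h1, c1E1]; exact hB1 h
    · refine ⟨(M ∪ A) ∪ B, ∅, preconn_un (preconn_un hMc hA (fk s k E0) (hM0 h0) hA0) hB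
        (fk s k E1) (Or.inl (hM1 h1)) hB1, isPreconnected_empty,
        ?_, by simp, ?_, ?_, by simp⟩
      · rintro ((h | h) | h)
        · exact hMs h
        · exact hsA h
        · exact hsB h
      · ext x
        have := hcov x
        simp only [mem_union, mem_univ, iff_true, mem_empty_iff_false, or_false]
        tauto
      · intro _; left; left; rw [hE0]; exact hMr

theorem esc (s : Sq m) {y : D m} (h : y ≠ pr s) : ∃ k, ∀ l ≥ k, y ∉ range (fk s l) := by
  obtain ⟨k, hk⟩ := lebesgue (m := m) (U := {y}ᶜ) (V := {pr s}ᶜ) isOpen_compl_singleton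
    isOpen_compl_singleton (by
      ext z; simp only [mem_union, mem_compl_iff, mem_singleton_iff, mem_univ, iff_true]
      by_contra! h'
      exact h (h'.1.symm.trans h'.2))
  refine ⟨k, fun l hl => ?_⟩
  obtain ⟨w, hw, hfw⟩ := fk_cw s l
  rcases hk w (by omega) with h | h
  · rintro ⟨z, hz⟩
    rw [hfw] at hz
    exact h z hz
  · exfalso
    have := h (pr (fun i => s (l + i)))
    rw [← hfw] at this
    exact this (fk_pr s l)

theorem order_le_two {x : D m} (hx : ¬ Br x) : ptOrder (D m) x = 1 ∨ ptOrder (D m) x = 2 := by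
  obtain ⟨s, rfl⟩ := pr_surj x
  have key : ∀ y1 y2 y3 : D m, y1 ≠ pr s → y2 ≠ pr s → y3 ≠ pr s →
      connectedComponentIn {pr s}ᶜ y1 = connectedComponentIn {pr s}ᶜ y2 ∨
      connectedComponentIn {pr s}ᶜ y1 = connectedComponentIn {pr s}ᶜ y3 ∨
      connectedComponentIn {pr s}ᶜ y2 = connectedComponentIn {pr s}ᶜ y3 := by
    intro y1 y2 y3 h1 h2 h3
    obtain ⟨k1, hk1⟩ := esc s h1
    obtain ⟨k2, hk2⟩ := esc s h2
    obtain ⟨k3, hk3⟩ := esc s h3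
    set k := max k1 (max k2 k3)
    obtain ⟨A, B, hA, hB, hsA, hsB, hU, -, -⟩ := two_sets s hx k
    have hcov : ∀ y, y ∉ range (fk s k) → y ∈ A ∨ y ∈ B := by
      intro y hy
      have : y ∈ A ∪ B ∪ range (fk s k) := by rw [hU]; trivial
      rcases this with h | h
      · exact h
      · exact absurd h hy
    have same : ∀ C : Set (D m), IsPreconnected C → pr s ∉ C → ∀ y z, y ∈ C → z ∈ C →
        connectedComponentIn {pr s}ᶜ y = connectedComponentIn {pr s}ᶜ z := by
      intro C hC hsC y z hy hz
      apply connectedComponentIn_eq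
      have hss : C ⊆ {pr s}ᶜ := fun t ht h => by
        have h2 : t = pr s := h
        exact hsC (h2 ▸ ht)
      exact hC.subset_connectedComponentIn hy hss hz
    have c1 := hcov y1 (hk1 k (le_max_left _ _))
    have c2 := hcov y2 (hk2 k ((le_max_left _ _).trans (le_max_right _ _)))
    have c3 := hcov y3 (hk3 k ((le_max_right _ _).trans (le_max_right _ _)))
    have sA := same A hA hsA
    have sB := same B hB hsB
    rcases c1 with c1 | c1 <;> rcases c2 with c2 | c2 <;> rcases c3 with c3 | c3
    · exact Or.inl (sA _ _ c1 c2)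
    · exact Or.inl (sA _ _ c1 c2)
    · exact Or.inr (Or.inl (sA _ _ c1 c3))
    · exact Or.inr (Or.inr (sB _ _ c2 c3))
    · exact Or.inr (Or.inr (sA _ _ c2 c3))
    · exact Or.inr (Or.inl (sB _ _ c1 c3))
    · exact Or.inl (sB _ _ c1 c2)
    · exact Or.inl (sB _ _ c1 c2)
  have hne : (setComponents (D m) {pr s}ᶜ).Nonempty :=
    ⟨_, rt, fun h => hx (h ▸ Br.root), rfl⟩
  by_cases h : ∃ y z : D m, y ≠ pr s ∧ z ≠ pr s ∧
      connectedComponentIn {pr s}ᶜ y ≠ connectedComponentIn {pr s}ᶜ z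
  · right
    obtain ⟨y, z, hy, hz, hyz⟩ := h
    have : setComponents (D m) {pr s}ᶜ =
        {connectedComponentIn {pr s}ᶜ y, connectedComponentIn {pr s}ᶜ z} := by
      ext C
      constructor
      · rintro ⟨t, ht, rfl⟩
        rcases key t y z ht hy hz with h | h | h
        · exact Or.inl h
        · exact Or.inr h
        · exact absurd h hyz
      · rintro (rfl | rfl)
        · exact ⟨y, hy, rfl⟩
        · exact ⟨z, hz, rfl⟩
    rw [ptOrder, this, ncard_pair hyz]
  · left
    push Not at h
    obtain ⟨C, y, hy, rfl⟩ := hne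
    have : setComponents (D m) {pr s}ᶜ = {connectedComponentIn {pr s}ᶜ y} := by
      ext C
      constructor
      · rintro ⟨t, ht, rfl⟩
        exact h t y ht hy
      · rintro rfl
        exact ⟨y, hy, rfl⟩
    rw [ptOrder, this, ncard_singleton]

end Waz
namespace Waz

open Set Filter

variable {m : ℕ}

/-! ### The homeomorphisms -/

abbrev H (m : ℕ) := D m ≃ₜ D m

@[simp] theorem mul_ap (f g : H m) (x : D m) : (f * g) x = f (g x) := rfl
@[simp] theorem one_ap (x : D m) : (1 : H m) x = x := rfl
@[simp] theorem inv_ap (f : H m) (x : D m) : f⁻¹ (f x) = x := f.symm_apply_apply x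
@[simp] theorem ap_inv (f : H m) (x : D m) : f (f⁻¹ x) = x := f.apply_symm_apply x
theorem inv_eq {f : H m} {x y : D m} (h : f x = y) : f⁻¹ y = x := by rw [← h, inv_ap]

def mkH (f g : D m → D m) (hf : Continuous f) (hg : Continuous g) (h1 : ∀ x, g (f x) = x)
    (h2 : ∀ x, f (g x) = x) : H m where
  toFun := f
  invFun := g
  left_inv := h1
  right_inv := h2
  continuous_toFun := hf
  continuous_invFun := hg

/-- Permutations of the cells. -/
def sgF (π : Equiv.Perm (Fin (m + 3))) : D m → D m :=
  glue (fun a => c (π a)) (fun _ _ => c_E0 _ _)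

def sg (π : Equiv.Perm (Fin (m + 3))) : H m :=
  mkH (sgF π) (sgF π⁻¹) (glue_cont _ _ fun a => c_cont _) (glue_cont _ _ fun a => c_cont _)
    (ext_c (g := fun x => x) fun a x => by simp [sgF])
    (ext_c (g := fun x => x) fun a x => by simp [sgF])

@[simp] theorem sg_c (π : Equiv.Perm (Fin (m + 3))) (a : Fin (m + 3)) (x : D m) :
    sg π (c a x) = c (π a) x := by
  show sgF π (c a x) = _
  simp [sgF]

def locF (g : D m → D m) (h : g E0 = E0) (a : Fin (m + 3)) : D m → D m :=
  glue (fun b z => c b (if b = a then g z else z)) (by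
    intro b b'
    have : ∀ b : Fin (m + 3), (if b = a then g E0 else E0) = E0 := by
      intro b; split_ifs <;> simp [h]
    simp only [this]
    exact c_E0 _ _)

theorem locF_cont {g : D m → D m} (h : g E0 = E0) (a : Fin (m + 3)) (hg : Continuous g) :
    Continuous (locF g h a) := by
  refine glue_cont _ _ fun b => (c_cont b).comp ?_
  by_cases hb : b = a
  · simpa [hb] using hg
  · simp only [hb, if_false]; exact continuous_id

/-- Local action on one cell. -/
def loc (a : Fin (m + 3)) (g : H m) (h : g E0 = E0) : H m :=
  mkH (locF g h a) (locF (g⁻¹ : H m) (inv_eq h) a) (locF_cont _ _ g.continuous)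
    (locF_cont _ _ (g⁻¹ : H m).continuous)
    (ext_c (g := fun x => x) fun b x => by
      by_cases hb : b = a <;> simp [locF, hb])
    (ext_c (g := fun x => x) fun b x => by
      by_cases hb : b = a <;> simp [locF, hb])

@[simp] theorem loc_same (a : Fin (m + 3)) (g : H m) (h : g E0 = E0) (z : D m) :
    loc a g h (c a z) = c a (g z) := by
  show locF g h a (c a z) = _
  simp [locF]

theorem loc_ne {a b : Fin (m + 3)} (hb : b ≠ a) (g : H m) (h : g E0 = E0) (z : D m) :
    loc a g h (c b z) = c b z := by
  show locF g h a (c b z) = _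
  simp [locF, hb]

def sw : Equiv.Perm (Fin (m + 3)) := Equiv.swap 0 1

@[simp] theorem sw_zero : (sw 0 : Fin (m + 3)) = 1 := Equiv.swap_apply_left _ _
@[simp] theorem sw_one : (sw 1 : Fin (m + 3)) = 0 := Equiv.swap_apply_right _ _
@[simp] theorem sw_sw (a : Fin (m + 3)) : sw (sw a) = a := Equiv.swap_apply_self _ _ _
theorem sw_of_ne {a : Fin (m + 3)} (h0 : a ≠ 0) (h1 : a ≠ 1) : sw a = a :=
  Equiv.swap_apply_of_ne_of_ne h0 h1
theorem sw_eq_one {a : Fin (m + 3)} : sw a = 1 ↔ a = 0 :=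
  ⟨fun h => by rw [← sw_sw a, h, sw_one], fun h => by rw [h, sw_zero]⟩
theorem sw_eq_zero {a : Fin (m + 3)} : sw a = 0 ↔ a = 1 :=
  ⟨fun h => by rw [← sw_sw a, h, sw_zero], fun h => by rw [h, sw_one]⟩
theorem one_ne_zero' : (1 : Fin (m + 3)) ≠ 0 := by simp

def rho : H m := sg sw
@[simp] theorem rho_c (a : Fin (m + 3)) (x : D m) : rho (c a x) = c (sw a) x := sg_c _ _ _
@[simp] theorem rho_rho (x : D m) : rho (rho x) = x :=
  ext_c (f := fun x => rho (rho x)) (g := fun x => x) (fun a x => by simp) x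
@[simp] theorem rho_E0 : (rho E0 : D m) = E1 := by rw [← c0E1, rho_c, sw_zero, c1E1]
@[simp] theorem rho_E1 : (rho E1 : D m) = E0 := by rw [← rho_E0, rho_rho]
@[simp] theorem rho_rt : (rho rt : D m) = rt := by rw [rt, rho_c, c_E0']; rfl

def beI : D m → D m :=
  glue (fun a y => if a = 0 then c 1 (c 0 (rho y)) else c (sw a) y) (by
    have : ∀ a : Fin (m + 3), (if a = 0 then c 1 (c 0 (rho E0)) else c (sw a) E0) = (rt : D m) := by
      intro a; split_ifs
      · rw [rho_E0, c0E1, c_E0']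
      · rw [c_E0']
    intro a b
    rw [this, this])

theorem beI_cont : Continuous (beI : D m → D m) := by
  refine glue_cont _ _ fun a => ?_
  by_cases ha : a = 0
  · simp only [ha, if_true]; exact (c_cont 1).comp ((c_cont 0).comp rho.continuous)
  · simpa [ha] using c_cont (sw a)

theorem beI_c0 (y : D m) : beI (c 0 y) = c 1 (c 0 (rho y)) := by simp [beI]
theorem beI_c {a : Fin (m + 3)} (ha : a ≠ 0) (y : D m) : beI (c a y) = c (sw a) y := by
  simp [beI, ha]

def beF : D m → D m :=
  glue (fun b y => if b = 1 then beI y else c 1 (c (sw b) y)) (by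
    have : ∀ a : Fin (m + 3), (if a = 1 then beI E0 else c 1 (c (sw a) E0)) = (c 1 rt : D m) := by
      intro a; split_ifs
      · rw [← c0E1, beI_c0, rho_E1, c_E0']
      · rw [c_E0']
    intro a b
    rw [this, this])

theorem beF_cont : Continuous (beF : D m → D m) := by
  refine glue_cont _ _ fun a => ?_
  by_cases ha : a = 1
  · simpa [ha] using beI_cont
  · simp only [ha, if_false]; exact (c_cont 1).comp (c_cont _)

theorem beF_ne {b : Fin (m + 3)} (hb : b ≠ 1) (y : D m) : beF (c b y) = c 1 (c (sw b) y) := by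
  simp [beF, hb]
theorem beF_10 (y : D m) : beF (c 1 (c 0 y)) = c 1 (c 0 (rho y)) := by simp [beF, beI_c0]
theorem beF_1 {a : Fin (m + 3)} (ha : a ≠ 0) (y : D m) : beF (c 1 (c a y)) = c (sw a) y := by
  simp [beF, beI_c ha]

theorem beF_beF (x : D m) : beF (beF x) = x := by
  obtain ⟨b, x, rfl⟩ := exists_c x
  by_cases hb : b = 1
  · subst hb
    obtain ⟨a, x, rfl⟩ := exists_c x
    by_cases ha : a = 0
    · subst ha
      rw [beF_10, beF_10, rho_rho]
    · rw [beF_1 ha, beF_ne (by rwa [Ne, sw_eq_one]), sw_sw]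
  · rw [beF_ne hb, beF_1 (by rwa [Ne, sw_eq_zero]), sw_sw]

def be : H m := mkH beF beF beF_cont beF_cont beF_beF beF_beF

theorem be_ne {b : Fin (m + 3)} (hb : b ≠ 1) (y : D m) : be (c b y) = c 1 (c (sw b) y) :=
  beF_ne hb y
theorem be_10 (y : D m) : be (c 1 (c 0 y)) = c 1 (c 0 (rho y)) := beF_10 y
theorem be_1 {a : Fin (m + 3)} (ha : a ≠ 0) (y : D m) : be (c 1 (c a y)) = c (sw a) y :=
  beF_1 ha y
theorem be_be (x : D m) : be (be x) = x := beF_beF x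

def xx : H m := be * rho

theorem xx_ne {a : Fin (m + 3)} (ha : a ≠ 0) (y : D m) : xx (c a y) = c 1 (c a y) := by
  rw [xx, mul_ap, rho_c, be_ne (by rwa [Ne, sw_eq_one]), sw_sw]
theorem xx_00 (y : D m) : xx (c 0 (c 0 y)) = c 1 (c 0 (rho y)) := by
  rw [xx, mul_ap, rho_c, sw_zero, be_10]
theorem xx_0 {a : Fin (m + 3)} (ha : a ≠ 0) (y : D m) : xx (c 0 (c a y)) = c (sw a) y := by
  rw [xx, mul_ap, rho_c, sw_zero, be_1 ha]
theorem xx_E0 : (xx E0 : D m) = E0 := by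
  conv_lhs => rw [← c0E1, ← c1E1]
  rw [xx_0 one_ne_zero', sw_one, c0E1]
theorem xx_E1 : (xx E1 : D m) = E1 := by
  conv_lhs => rw [← c1E1]
  rw [xx_ne one_ne_zero', c1E1, c1E1]

def X1 : H m := loc 1 xx xx_E0
theorem l0x_E0 : (loc 0 xx xx_E0 E0 : D m) = E0 := by
  conv_lhs => rw [← c0E1]
  rw [loc_same, xx_E1, c0E1]
def X10 : H m := loc 1 (loc 0 xx xx_E0) l0x_E0

/-- The group. -/
def G (m : ℕ) : Subgroup (H m) := Subgroup.closure (range sg ∪ {be, X1, X10})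

theorem G_fg : (G m).FG := by
  rw [Subgroup.fg_iff]
  exact ⟨_, rfl, (finite_range _).union (by simp)⟩

theorem sg_mem (π : Equiv.Perm (Fin (m + 3))) : sg π ∈ G m :=
  Subgroup.subset_closure (Or.inl ⟨π, rfl⟩)
theorem be_mem : be ∈ G m := Subgroup.subset_closure (Or.inr (by simp))
theorem X1_mem : X1 ∈ G m := Subgroup.subset_closure (Or.inr (by simp))
theorem X10_mem : X10 ∈ G m := Subgroup.subset_closure (Or.inr (by simp))

/-- `φ` extends, by the identity, the copy of `g` on the range of `f`. -/
def Ext (f : D m → D m) (g φ : H m) : Prop :=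
  (∀ z, φ (f z) = f (g z)) ∧ ∀ y, y ∉ range f → φ y = y

def InG (f : D m → D m) (g : H m) : Prop := ∃ φ ∈ G m, Ext f g φ

theorem Ext.conj {f f' : D m → D m} {g φ k : H m} (h : Ext f g φ) (hk : ∀ z, k (f z) = f' z) :
    Ext f' g (k * φ * k⁻¹) := by
  constructor
  · intro z
    rw [← hk, mul_ap, mul_ap, inv_ap, h.1, hk]
  · intro y hy
    rw [mul_ap, mul_ap, h.2, ap_inv]
    rintro ⟨z, hz⟩
    exact hy ⟨z, by rw [← hk, hz, ap_inv]⟩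

theorem InG.conj {f f' : D m → D m} {g k : H m} (h : InG f g) (hkG : k ∈ G m)
    (hk : ∀ z, k (f z) = f' z) : InG f' g := by
  obtain ⟨φ, hφ, hE⟩ := h
  exact ⟨_, mul_mem (mul_mem hkG hφ) (inv_mem hkG), hE.conj hk⟩

theorem Ext.comp {f : D m → D m} {a : Fin (m + 3)} {g ψ φ : H m} (h1 : Ext (c a) g ψ)
    (h2 : Ext f ψ φ) : Ext (fun z => f (c a z)) g φ := by
  constructor
  · intro z
    show φ (f (c a z)) = f (c a (g z))
    rw [h2.1, h1.1]
  · intro y hy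
    by_cases hyf : y ∈ range f
    · obtain ⟨z, rfl⟩ := hyf
      rw [h2.1, h1.2]
      rintro ⟨w, rfl⟩
      exact hy ⟨w, rfl⟩
    · exact h2.2 _ hyf

theorem Ext.nest {f : D m → D m} (hf : Function.Injective f) {a : Fin (m + 3)} {g ψ φ : H m}
    (h1 : Ext (c a) g ψ) (h2 : Ext (fun z => f (c a z)) g φ) : Ext f ψ φ := by
  constructor
  · intro z
    by_cases hz : z ∈ range (c a)
    · obtain ⟨w, rfl⟩ := hz
      rw [h1.1]; exact h2.1 w
    · rw [h1.2 _ hz, h2.2]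
      rintro ⟨w, hw⟩
      exact hz ⟨w, hf hw⟩
  · intro y hy
    apply h2.2
    rintro ⟨w, rfl⟩
    exact hy ⟨_, rfl⟩

theorem not_range {a : Fin (m + 3)} {y : D m} (h : y ∉ range (c a)) : ∃ b z, b ≠ a ∧ y = c b z := by
  obtain ⟨b, z, rfl⟩ := exists_c y
  refine ⟨b, z, ?_, rfl⟩
  rintro rfl
  exact h ⟨z, rfl⟩

theorem ext_loc (a : Fin (m + 3)) (g : H m) (h : g E0 = E0) : Ext (c a) g (loc a g h) := by
  constructor
  · intro z; simp
  · intro y hy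
    obtain ⟨b, z, hb, rfl⟩ := not_range hy
    exact loc_ne hb _ _ _

theorem InG.loc {f : D m → D m} (hf : Function.Injective f) {a : Fin (m + 3)} {g : H m}
    (h : g E0 = E0) (h2 : InG (fun z => f (c a z)) g) : InG f (loc a g h) := by
  obtain ⟨φ, hφ, hE⟩ := h2
  exact ⟨φ, hφ, (ext_loc a g h).nest hf hE⟩

theorem InG.mul {f : D m → D m} {g g' : H m} (h : InG f g) (h' : InG f g') : InG f (g * g') := by
  obtain ⟨φ, hφ, hE⟩ := h
  obtain ⟨φ', hφ', hE'⟩ := h'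
  refine ⟨φ * φ', mul_mem hφ hφ', fun z => ?_, fun y hy => ?_⟩
  · rw [mul_ap, hE'.1, hE.1, mul_ap]
  · rw [mul_ap, hE'.2 _ hy, hE.2 _ hy]

theorem InG.one {f : D m → D m} : InG f 1 :=
  ⟨1, one_mem _, fun _ => rfl, fun _ _ => rfl⟩

theorem InG.inv {f : D m → D m} {g : H m} (h : InG f g) : InG f g⁻¹ := by
  obtain ⟨φ, hφ, hE⟩ := h
  refine ⟨φ⁻¹, inv_mem hφ, fun z => ?_, fun y hy => ?_⟩
  · apply inv_eq; rw [hE.1, ap_inv]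
  · apply inv_eq; exact hE.2 _ hy

def fB (z : D m) : D m := c 1 (c 0 z)
theorem fB_inj : Function.Injective (fB : D m → D m) := (c_inj 1).comp (c_inj 0)

def Γ1 (m : ℕ) : Subgroup (H m) where
  carrier := {g | InG (c 1) g ∧ g E0 = E0}
  mul_mem' := fun {a b} ha hb => ⟨ha.1.mul hb.1, by rw [mul_ap, hb.2, ha.2]⟩
  one_mem' := ⟨InG.one, rfl⟩
  inv_mem' := fun {a} ha => ⟨ha.1.inv, inv_eq ha.2⟩

def Γ2 (m : ℕ) : Subgroup (H m) where
  carrier := {g | InG fB g ∧ g E0 = E0 ∧ g E1 = E1}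
  mul_mem' := fun {a b} ha hb =>
    ⟨ha.1.mul hb.1, by rw [mul_ap, hb.2.1, ha.2.1], by rw [mul_ap, hb.2.2, ha.2.2]⟩
  one_mem' := ⟨InG.one, rfl, rfl⟩
  inv_mem' := fun {a} ha => ⟨ha.1.inv, inv_eq ha.2.1, inv_eq ha.2.2⟩

theorem loc_E0 {a : Fin (m + 3)} {g : H m} (h : g E0 = E0) (h' : a = 0 → g E1 = E1) :
    loc a g h E0 = E0 := by
  conv_lhs => rw [← c0E1]
  by_cases ha : a = 0
  · subst ha; rw [loc_same, h' rfl, c0E1]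
  · rw [loc_ne (Ne.symm ha), c0E1]

theorem loc_E1 {a : Fin (m + 3)} {g : H m} (h : g E0 = E0) (h' : a = 1 → g E1 = E1) :
    loc a g h E1 = E1 := by
  conv_lhs => rw [← c1E1]
  by_cases ha : a = 1
  · subst ha; rw [loc_same, h' rfl, c1E1]
  · rw [loc_ne (Ne.symm ha), c1E1]

theorem xx_Γ1 : xx ∈ Γ1 m := ⟨⟨X1, X1_mem, ext_loc _ _ _⟩, xx_E0⟩
theorem l0x_Γ1 : loc 0 xx xx_E0 ∈ Γ1 m := ⟨⟨X10, X10_mem, ext_loc _ _ _⟩, l0x_E0⟩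
theorem xx_Γ2 : xx ∈ Γ2 m :=
  ⟨⟨X10, X10_mem, (ext_loc 0 xx xx_E0).comp (ext_loc 1 _ l0x_E0)⟩, xx_E0, xx_E1⟩

theorem sg_E0 {κ : Equiv.Perm (Fin (m + 3))} (h : κ 0 = 0) : sg κ E0 = (E0 : D m) := by
  conv_lhs => rw [← c0E1]
  rw [sg_c, h, c0E1]
theorem sg_E1 {κ : Equiv.Perm (Fin (m + 3))} (h : κ 1 = 1) : sg κ E1 = (E1 : D m) := by
  conv_lhs => rw [← c1E1]
  rw [sg_c, h, c1E1]
theorem sg_rt (κ : Equiv.Perm (Fin (m + 3))) : sg κ rt = (rt : D m) := by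
  rw [rt, sg_c, c_E0']; rfl

theorem sg_Γ1 {κ : Equiv.Perm (Fin (m + 3))} (h : κ 0 = 0) : sg κ ∈ Γ1 m := by
  refine ⟨⟨be * sg (sw * κ * sw) * be, mul_mem (mul_mem be_mem (sg_mem _)) be_mem, ?_, ?_⟩, sg_E0 h⟩
  · intro z
    obtain ⟨a, y, rfl⟩ := exists_c z
    by_cases ha : a = 0
    · subst ha
      simp [be_10, h]
    · have h2 : κ a ≠ 0 := fun h3 => ha (κ.injective (h3.trans h.symm))
      simp only [mul_ap, be_1 ha, sg_c, Equiv.Perm.mul_apply, sw_sw]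
      rw [be_ne (by rwa [Ne, sw_eq_one]), sw_sw]
  · intro y hy
    obtain ⟨b, z, hb, rfl⟩ := not_range hy
    simp only [mul_ap, be_ne hb, sg_c, Equiv.Perm.mul_apply, sw_one, h, sw_zero]
    rw [be_1 (by rwa [Ne, sw_eq_zero]), sw_sw]

theorem sg_Γ2 {κ : Equiv.Perm (Fin (m + 3))} (h : κ 0 = 0) (h1 : κ 1 = 1) : sg κ ∈ Γ2 m := by
  obtain ⟨⟨φ, hφ, hE⟩, -⟩ := sg_Γ1 h
  have hsw : ∀ a, κ (sw a) = sw (κ a) := by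
    intro a
    by_cases ha : a = 0
    · simp [ha, h, h1]
    by_cases ha1 : a = 1
    · simp [ha1, h, h1]
    have h2 : κ a ≠ 0 := fun h3 => ha (κ.injective (h3.trans h.symm))
    have h3 : κ a ≠ 1 := fun h3 => ha1 (κ.injective (h3.trans h1.symm))
    rw [sw_of_ne ha ha1, sw_of_ne h2 h3]
  refine ⟨⟨X1⁻¹ * φ * X1, mul_mem (mul_mem (inv_mem X1_mem) hφ) X1_mem, ?_, ?_⟩, sg_E0 h, sg_E1 h1⟩
  · intro z
    rw [mul_ap, mul_ap]
    apply inv_eq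
    obtain ⟨a, y, rfl⟩ := exists_c z
    unfold fB X1
    rw [loc_same, loc_same]
    by_cases ha : a = 0
    · subst ha
      rw [sg_c, h, xx_00, hE.1, sg_c, h1]
    · have h2 : κ a ≠ 0 := fun h3 => ha (κ.injective (h3.trans h.symm))
      rw [sg_c, xx_0 ha, xx_0 h2, hE.1, sg_c, hsw]
  · intro y hy
    rw [mul_ap, mul_ap]
    apply inv_eq
    unfold X1
    by_cases hy1 : y ∈ range (c 1)
    · obtain ⟨z, rfl⟩ := hy1
      have : z ∉ range (c 0) := by
        rintro ⟨w, rfl⟩; exact hy ⟨w, rfl⟩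
      obtain ⟨a, y, ha, rfl⟩ := not_range this
      rw [loc_same, xx_ne ha, hE.1, sg_c, h1]
    · obtain ⟨b, z, hb, rfl⟩ := not_range hy1
      rw [loc_ne hb, hE.2 _ hy1]

theorem lift_c {g : H m} (h : InG (c 1) g) (a : Fin (m + 3)) : InG (c a) g :=
  h.conj (sg_mem (Equiv.swap 1 a)) fun z => by rw [sg_c, Equiv.swap_apply_left]

theorem lift11 {g : H m} (h : g ∈ Γ1 m) {a : Fin (m + 3)} (ha : a ≠ 0) :
    InG (fun z => c 1 (c a z)) g :=
  (lift_c h.1 (sw a)).conj be_mem fun z => by rw [be_ne (by rwa [Ne, sw_eq_one]), sw_sw]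

theorem loc_Γ1_0 {g : H m} (h : g ∈ Γ2 m) : loc 0 g h.2.1 ∈ Γ1 m :=
  ⟨InG.loc (c_inj 1) _ h.1, loc_E0 _ fun _ => h.2.2⟩

theorem loc_Γ1_ne {g : H m} (h : g ∈ Γ1 m) {a : Fin (m + 3)} (ha : a ≠ 0) :
    loc a g h.2 ∈ Γ1 m :=
  ⟨InG.loc (c_inj 1) _ (lift11 h ha), loc_E0 _ fun h => absurd h ha⟩

theorem l0x_Γ2 : loc 0 xx xx_E0 ∈ Γ2 m := by
  refine ⟨InG.loc fB_inj _ ?_, l0x_E0, loc_E1 _ (fun h => absurd h.symm one_ne_zero')⟩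
  refine (xx_Γ2.1).conj (k := (be * sg sw * be * X1)⁻¹)
    (inv_mem (mul_mem (mul_mem (mul_mem be_mem (sg_mem _)) be_mem) X1_mem)) fun z => ?_
  apply inv_eq
  simp only [mul_ap, fB, X1, loc_same, xx_00, be_1 one_ne_zero', sw_one, sg_c, sw_zero, be_10,
    rho_rho]

theorem loc_Γ2_0 {g : H m} (h : g ∈ Γ2 m) : loc 0 g h.2.1 ∈ Γ2 m := by
  refine ⟨InG.loc fB_inj _ ?_, loc_E0 _ (fun _ => h.2.2),
    loc_E1 _ (fun h => absurd h.symm one_ne_zero')⟩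
  refine (h.1).conj (k := (be * sg sw * be * X1)⁻¹)
    (inv_mem (mul_mem (mul_mem (mul_mem be_mem (sg_mem _)) be_mem) X1_mem)) fun z => ?_
  apply inv_eq
  simp only [mul_ap, fB, X1, loc_same, xx_00, be_1 one_ne_zero', sw_one, sg_c, sw_zero, be_10,
    rho_rho]

theorem loc_Γ2_1 {g : H m} (h : g ∈ Γ2 m) : loc 1 g h.2.1 ∈ Γ2 m := by
  refine ⟨InG.loc fB_inj _ ?_, loc_E0 _ (fun _ => h.2.2), loc_E1 _ (fun _ => h.2.2)⟩
  refine (h.1).conj (k := X1⁻¹) (inv_mem X1_mem) fun z => ?_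
  apply inv_eq
  simp only [fB, X1, loc_same, xx_0 one_ne_zero', sw_one]

theorem loc_Γ2_ne {g : H m} (h : g ∈ Γ1 m) {a : Fin (m + 3)} (ha : a ≠ 0) (ha1 : a ≠ 1) :
    loc a g h.2 ∈ Γ2 m := by
  refine ⟨InG.loc fB_inj _ ?_, loc_E0 _ (fun h => absurd h ha), loc_E1 _ (fun h => absurd h ha1)⟩
  refine (lift11 h ha).conj (k := X1⁻¹) (inv_mem X1_mem) fun z => ?_
  apply inv_eq
  simp only [fB, X1, loc_same, xx_0 ha, sw_of_ne ha ha1]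

end Waz
namespace Waz

open Set Filter

variable {m : ℕ}

def pt : List (Fin (m + 3)) → D m
  | [] => rt
  | a :: w => c a (pt w)

theorem Br.pt {p : D m} (h : Br p) : ∃ w, p = pt w := by
  induction h with
  | root => exact ⟨[], rfl⟩
  | cons a p _ ih =>
    obtain ⟨w, rfl⟩ := ih
    exact ⟨a :: w, rfl⟩

theorem br_pt (w : List (Fin (m + 3))) : Br (pt w) := by
  induction w with
  | nil => exact Br.root
  | cons a w ih => exact Br.cons a _ ih

def rl : List (Fin (m + 3)) → List (Fin (m + 3))
  | [] => []
  | a :: w => sw a :: w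

theorem rho_pt (w : List (Fin (m + 3))) : rho (pt w) = pt (rl w) := by
  cases w with
  | nil => exact rho_rt
  | cons a w => exact rho_c _ _

theorem rl_len (w : List (Fin (m + 3))) : (rl w).length = w.length := by
  cases w <;> rfl

theorem xx_c0_rt : xx (c 0 rt) = (rt : D m) := by
  rw [← c_E0' 1, xx_0 one_ne_zero', sw_one, c_E0', c_E0']

theorem xx_rt : xx rt = (c 1 rt : D m) := by
  conv_lhs => rw [← c_E0' 1]
  rw [xx_ne one_ne_zero', c_E0']

theorem trans_aux (Γ : Subgroup (H m)) (A : Fin (m + 3) → Prop) (hx : xx ∈ Γ)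
    (hlx : loc 0 xx xx_E0 ∈ Γ) (A0 : A 0) (Asw : ∀ a, A a → A (sw a))
    (hκ : ∀ b, A b → b ≠ 0 → ∃ κ, sg κ ∈ Γ ∧ κ b = 1) :
    ∀ (k : ℕ) (w : List (Fin (m + 3))), w.length = k → (∀ a ∈ w, A a) →
      ∃ g ∈ Γ, g (pt w) = rt := by
  intro k
  induction k using Nat.strong_induction_on with
  | _ k ih =>
  have red : ∀ (w w' : List (Fin (m + 3))) (g : H m), g ∈ Γ → g (pt w) = pt w' →
      (∃ g ∈ Γ, g (pt w') = rt) → ∃ g ∈ Γ, g (pt w) = rt := by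
    rintro w w' g hg h ⟨g', hg', h'⟩
    exact ⟨g' * g, mul_mem hg' hg, by rw [mul_ap, h, h']⟩
  have Arl : ∀ w : List (Fin (m + 3)), (∀ a ∈ w, A a) → ∀ a ∈ rl w, A a := by
    intro w hw
    cases w with
    | nil => exact hw
    | cons a w =>
      intro b hb
      rcases List.mem_cons.1 hb with rfl | hb
      · exact Asw _ (hw _ (by simp))
      · exact hw _ (by simp [hb])
  have case00 : ∀ u : List (Fin (m + 3)), u.length + 2 = k → (∀ a ∈ u, A a) →
      ∃ g ∈ Γ, g (pt (0 :: 0 :: u)) = rt := by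
    intro u hu hA
    rcases u with _ | ⟨a, u⟩
    · refine red _ [0] _ hlx ?_ (ih 1 (by simp at hu; omega) _ rfl (by simpa using A0))
      show loc 0 xx xx_E0 (c 0 (c 0 rt)) = c 0 rt
      rw [loc_same, xx_c0_rt]
    · simp only [List.length_cons] at hu
      have hAu : ∀ a ∈ u, A a := fun b hb => hA b (by simp [hb])
      by_cases ha : a = 0
      · subst ha
        refine red _ (0 :: 1 :: 0 :: rl u) _ hlx ?_ (red _ (0 :: 0 :: rl u) _ hx ?_
          (ih _ (show (rl u).length + 2 < k by rw [rl_len]; omega) _ (by simp) ?_))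
        · show loc 0 xx xx_E0 (c 0 (c 0 (c 0 (pt u)))) = c 0 (c 1 (c 0 (pt (rl u))))
          rw [loc_same, xx_00, rho_pt]
        · show xx (c 0 (c 1 (c 0 (pt (rl u))))) = c 0 (c 0 (pt (rl u)))
          rw [xx_0 one_ne_zero', sw_one]
        · intro b hb
          simp only [List.mem_cons] at hb
          rcases hb with rfl | rfl | hb
          · exact A0
          · exact A0
          · exact Arl u hAu b hb
      · refine red _ (0 :: sw a :: u) _ hlx ?_
          (ih _ (show u.length + 2 < k by omega) _ (by simp) ?_)
        · show loc 0 xx xx_E0 (c 0 (c 0 (c a (pt u)))) = c 0 (c (sw a) (pt u))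
          rw [loc_same, xx_0 ha]
        · intro b hb
          simp only [List.mem_cons] at hb
          rcases hb with rfl | rfl | hb
          · exact A0
          · exact Asw _ (hA _ (by simp))
          · exact hAu b hb
  have case1 : ∀ u : List (Fin (m + 3)), u.length + 1 = k → (∀ a ∈ u, A a) →
      ∃ g ∈ Γ, g (pt (1 :: u)) = rt := by
    intro u hu hA
    rcases u with _ | ⟨a, u⟩
    · exact ⟨xx⁻¹, inv_mem hx, inv_eq xx_rt⟩
    · simp only [List.length_cons] at hu
      have hAu : ∀ a ∈ u, A a := fun b hb => hA b (by simp [hb])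
      by_cases ha : a = 0
      · subst ha
        refine red _ (0 :: 0 :: rl u) _ (inv_mem hx) ?_ (case00 _ (by rw [rl_len]; omega) (Arl _ hAu))
        apply inv_eq
        show xx (c 0 (c 0 (pt (rl u)))) = c 1 (c 0 (pt u))
        rw [xx_00, ← rho_pt, rho_rho]
      · refine red _ (a :: u) _ (inv_mem hx) ?_ (ih _ (show u.length + 1 < k by omega) _ (by simp) hA)
        apply inv_eq
        exact xx_ne ha _
  intro w hw hA
  rcases w with _ | ⟨b, u⟩
  · exact ⟨1, one_mem _, rfl⟩
  simp only [List.length_cons] at hw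
  have hAu : ∀ a ∈ u, A a := fun b hb => hA b (by simp [hb])
  by_cases hb : b = 0
  · subst hb
    rcases u with _ | ⟨a, u⟩
    · exact ⟨xx, hx, xx_c0_rt⟩
    · simp only [List.length_cons] at hw
      have hAu' : ∀ a ∈ u, A a := fun b hb => hAu b (by simp [hb])
      by_cases ha : a = 0
      · subst ha
        exact case00 u hw hAu'
      · refine red _ (sw a :: u) _ hx ?_ (ih _ (show u.length + 1 < k by omega) _ (by simp) ?_)
        · exact xx_0 ha _
        · intro b hb
          simp only [List.mem_cons] at hb
          rcases hb with rfl | hb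
          · exact Asw _ (hAu _ (by simp))
          · exact hAu' b hb
  · obtain ⟨κ, hκ1, hκ2⟩ := hκ b (hA b (by simp)) hb
    refine red _ (1 :: u) _ hκ1 ?_ (case1 _ hw hAu)
    show sg κ (c b (pt u)) = c 1 (pt u)
    rw [sg_c, hκ2]

theorem Γ1_trans {p : D m} (h : Br p) : ∃ g ∈ Γ1 m, g p = rt := by
  obtain ⟨w, rfl⟩ := h.pt
  refine trans_aux (Γ1 m) (fun _ => True) xx_Γ1 l0x_Γ1 trivial (fun _ _ => trivial) ?_ _ w
    rfl (fun _ _ => trivial)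
  intro b _ hb
  exact ⟨Equiv.swap b 1, sg_Γ1 (Equiv.swap_apply_of_ne_of_ne hb.symm one_ne_zero'.symm),
    Equiv.swap_apply_left _ _⟩

theorem Γ2_trans (w : List (Fin (m + 3))) (h : ∀ a ∈ w, a = 0 ∨ a = 1) :
    ∃ g ∈ Γ2 m, g (pt w) = rt := by
  refine trans_aux (Γ2 m) (fun a => a = 0 ∨ a = 1) xx_Γ2 l0x_Γ2 (Or.inl rfl) ?_ ?_ _ w
    rfl h
  · rintro a (rfl | rfl) <;> simp
  · intro b hb hb0
    exact ⟨1, sg_Γ2 rfl rfl, hb.resolve_left hb0⟩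

theorem be_c1rt : be (c 1 rt) = (rt : D m) := by
  rw [← c_E0' 1, be_1 one_ne_zero', c_E0', c_E0']

theorem G_trans {p : D m} (h : Br p) : ∃ g ∈ G m, g p = rt := by
  cases h with
  | root => exact ⟨1, one_mem _, rfl⟩
  | cons a p hp =>
    obtain ⟨g, hg, hgp⟩ := Γ1_trans hp
    obtain ⟨φ, hφ, hE⟩ := lift_c hg.1 a
    refine ⟨be * sg (Equiv.swap a 1) * φ, mul_mem (mul_mem be_mem (sg_mem _)) hφ, ?_⟩
    rw [mul_ap, mul_ap, hE.1, hgp, sg_c, Equiv.swap_apply_left, be_c1rt]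

theorem comps_image (h : H m) (p : D m) :
    setComponents (D m) {h p}ᶜ = image h '' setComponents (D m) {p}ᶜ := by
  have hc : h '' {p}ᶜ = {h p}ᶜ := by
    rw [image_compl_eq h.bijective, image_singleton]
  ext C
  constructor
  · rintro ⟨y, hy, rfl⟩
    obtain ⟨x, rfl⟩ := h.surjective y
    have hx : x ∈ ({p}ᶜ : Set (D m)) := by
      intro hxp
      have : x = p := hxp
      exact hy (by rw [this]; rfl)
    refine ⟨_, ⟨x, hx, rfl⟩, ?_⟩
    rw [h.image_connectedComponentIn hx, hc]
  · rintro ⟨_, ⟨x, hx, rfl⟩, rfl⟩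
    refine ⟨h x, ?_, ?_⟩
    · rw [← hc]; exact ⟨x, hx, rfl⟩
    · rw [h.image_connectedComponentIn hx, hc]

theorem order_image (h : H m) (p : D m) : ptOrder (D m) (h p) = ptOrder (D m) p := by
  rw [ptOrder, comps_image, ncard_image_of_injective _ h.injective.image_injective]
  rfl

theorem order_iff {p : D m} : ptOrder (D m) p = m + 3 ↔ Br p := by
  constructor
  · intro h
    by_contra hp
    rcases order_le_two hp with h' | h' <;> omega
  · intro h
    obtain ⟨g, -, hg⟩ := G_trans h
    rw [← order_image g, hg, order_rt]

theorem br_image (h : H m) {p : D m} (hp : Br p) : Br (h p) := by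
  rw [← order_iff, order_image, order_iff]; exact hp

/-! ### The commutator subgroup -/

theorem N_le : ⁅G m, G m⁆ ≤ G m := Subgroup.commutator_le_self _

def comm (k g : H m) : H m := k * g * k⁻¹ * g⁻¹
theorem comm_def (k g : H m) : comm k g = k * g * k⁻¹ * g⁻¹ := rfl
theorem comm_mem {k g : H m} (hk : k ∈ G m) (hg : g ∈ G m) : comm k g ∈ ⁅G m, G m⁆ :=
  Subgroup.commutator_mem_commutator hk hg


def Eq' (p q : D m) : Prop := ∃ g ∈ ⁅G m, G m⁆, g p = q

theorem Eq'.refl (p : D m) : Eq' p p := ⟨1, one_mem _, rfl⟩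
theorem Eq'.symm {p q : D m} (h : Eq' p q) : Eq' q p := by
  obtain ⟨g, hg, h⟩ := h
  exact ⟨g⁻¹, inv_mem hg, inv_eq h⟩
theorem Eq'.trans {p q r : D m} (h : Eq' p q) (h' : Eq' q r) : Eq' p r := by
  obtain ⟨g, hg, h⟩ := h
  obtain ⟨g', hg', h'⟩ := h'
  exact ⟨g' * g, mul_mem hg' hg, by rw [mul_ap, h, h']⟩
theorem Eq'.map {p q : D m} (h : Eq' p q) {k : H m} (hk : k ∈ G m) : Eq' (k p) (k q) := by
  obtain ⟨g, hg, h⟩ := h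
  refine ⟨comm k g * g, mul_mem (comm_mem hk (N_le hg)) hg, ?_⟩
  rw [comm_def]
  simp [h]

theorem exists_ne (a : Fin (m + 3)) : ∃ b : Fin (m + 3), b ≠ a := by
  by_cases h : a = 0
  · exact ⟨1, by rw [h]; exact one_ne_zero'⟩
  · exact ⟨0, Ne.symm h⟩

theorem eq_cons (a : Fin (m + 3)) {p : D m} (hp : Br p) : Eq' (c a p) (c a rt) := by
  obtain ⟨g, hg, hgp⟩ := Γ1_trans hp
  obtain ⟨φ, hφ, hE⟩ := lift_c hg.1 a
  obtain ⟨b, hb⟩ := exists_ne a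
  refine ⟨comm φ (sg (Equiv.swap a b)), comm_mem hφ (sg_mem _), ?_⟩
  rw [comm_def]
  have h1 : (sg (Equiv.swap a b))⁻¹ (c a p) = c b p := by
    apply inv_eq; rw [sg_c, Equiv.swap_apply_right]
  have h2 : φ⁻¹ (c b p) = c b p := by
    apply inv_eq
    apply hE.2
    rintro ⟨z, hz⟩
    rcases c_eq.1 hz with h | h
    · exact hb h.1.symm
    · exact hp.ne.1 h.2
  rw [mul_ap, mul_ap, mul_ap, h1, h2, sg_c, Equiv.swap_apply_right, hE.1, hgp]

theorem eq_rt {p : D m} (hp : Br p) : Eq' p rt := by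
  have h0 : Eq' (rt : D m) (c 0 rt) := by
    have := ((eq_cons (1 : Fin (m + 3)) (Br.cons 1 _ Br.root)).map be_mem).symm
    rwa [be_c1rt, be_1 one_ne_zero', sw_one] at this
  have h1 : ∀ a : Fin (m + 3), Eq' (c a rt) (rt : D m) := by
    intro a
    have := h0.map (sg_mem (Equiv.swap 0 a))
    rw [sg_rt, sg_c, Equiv.swap_apply_left] at this
    exact this.symm
  cases hp with
  | root => exact Eq'.refl _
  | cons a p hp => exact (eq_cons a hp).trans (h1 a)

theorem N_trans {p q : D m} (hp : Br p) (hq : Br q) : Eq' p q := (eq_rt hp).trans (eq_rt hq).symm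

theorem sg_Ub (π : Equiv.Perm (Fin (m + 3))) (a : Fin (m + 3)) :
    sg π '' Ub a = (Ub (π a) : Set (D m)) := by
  rw [Ub, Ub, image_image]
  simp

theorem exists_third (a b : Fin (m + 3)) : ∃ d : Fin (m + 3), d ≠ a ∧ d ≠ b := by
  have : ({a, b} : Finset (Fin (m + 3))).card < Fintype.card (Fin (m + 3)) := by
    rw [Fintype.card_fin]
    exact lt_of_le_of_lt Finset.card_le_two (by omega)
  obtain ⟨d, hd⟩ := Finset.exists_mem_notMem_of_card_lt_card (s := {a, b}) (t := Finset.univ)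
    (by simpa using this)
  refine ⟨d, ?_⟩
  simpa [not_or] using hd.2

theorem N_Ub (a b : Fin (m + 3)) : ∃ h ∈ ⁅G m, G m⁆, (h : H m) '' Ub a = Ub b := by
  by_cases hab : a = b
  · refine ⟨1, one_mem _, ?_⟩
    rw [hab]
    exact image_id _
  obtain ⟨d, hda, hdb⟩ := exists_third a b
  refine ⟨comm (sg (Equiv.swap a b)) (sg (Equiv.swap a d)),
    comm_mem (sg_mem _) (sg_mem _), ?_⟩
  have hinv : ∀ x y : Fin (m + 3), (sg (Equiv.swap x y))⁻¹ = (sg (Equiv.swap x y) : H m) := by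
    intro x y
    rw [inv_eq_iff_mul_eq_one]
    apply Homeomorph.ext
    intro z
    exact ext_c (f := fun z => sg (Equiv.swap x y) (sg (Equiv.swap x y) z)) (g := fun z => z)
      (fun a z => by simp) z
  rw [comm_def, hinv, hinv]
  have hmul : ∀ (f g : H m) (S : Set (D m)), (f * g) '' S = f '' (g '' S) := by
    intro f g S; rw [image_image]; rfl
  rw [hmul, hmul, hmul, sg_Ub, sg_Ub, sg_Ub, sg_Ub]
  congr 1
  rw [Equiv.swap_apply_left, Equiv.swap_apply_of_ne_of_ne hda hdb, Equiv.swap_apply_right,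
    Equiv.swap_apply_left]

theorem N_branch {p q : D m} (hp : Br p) (hq : Br q) {B B' : Set (D m)}
    (hB : B ∈ setComponents (D m) {p}ᶜ) (hB' : B' ∈ setComponents (D m) {q}ᶜ) :
    ∃ h ∈ ⁅G m, G m⁆, (h : H m) '' B = B' := by
  obtain ⟨g, hg, hgp⟩ := eq_rt hp
  obtain ⟨gq, hgN, hgq⟩ := eq_rt hq
  have hmul : ∀ (f g : H m) (S : Set (D m)), (f * g) '' S = f '' (g '' S) := by
    intro f g S; rw [image_image]; rfl
  have h1 : g '' B ∈ setComponents (D m) {g p}ᶜ := by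
    rw [comps_image]; exact ⟨B, hB, rfl⟩
  have h2 : gq '' B' ∈ setComponents (D m) {gq q}ᶜ := by
    rw [comps_image]; exact ⟨B', hB', rfl⟩
  rw [hgp, comps_rt] at h1
  rw [hgq, comps_rt] at h2
  obtain ⟨a, ha⟩ := h1
  obtain ⟨b, hb⟩ := h2
  obtain ⟨k, hk, hkab⟩ := N_Ub a b
  refine ⟨gq⁻¹ * k * g, mul_mem (mul_mem (inv_mem hgN) hk) hg, ?_⟩
  rw [hmul, hmul, ← ha, hkab, hb, ← hmul, inv_mul_cancel]
  exact image_id _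

end Waz
namespace Waz

open Set Filter

variable {m : ℕ}

theorem Sep.map {p x y : D m} (h : Sep p x y) (f : H m) : Sep (f p) (f x) (f y) := by
  obtain ⟨U, V, h1, h2, h3, h4, h5, h6⟩ := h
  refine ⟨f '' U, f '' V, f.isOpenMap _ h1, f.isOpenMap _ h2,
    (disjoint_image_iff f.injective).2 h3, ?_, ⟨x, h5, rfl⟩, ⟨y, h6, rfl⟩⟩
  rw [← image_union, h4, image_compl_eq f.bijective, image_singleton]

theorem Sep.step {p x y z : D m} (h : Sep p x y) {C : Set (D m)} (hC : IsPreconnected C)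
    (hp : p ∉ C) (hy : y ∈ C) (hz : z ∈ C) : Sep p x z := by
  obtain ⟨U, V, h1, h2, h3, h4, h5, h6⟩ := h
  have : z ∈ U ∪ V := by
    rw [h4]; intro hzp
    have : z = p := hzp
    exact hp (this ▸ hz)
  rcases this with hzU | hzV
  · exact (Sep.not_conn ⟨U, V, h1, h2, h3, h4, hzU, h6⟩ hC hp hz hy).elim
  · exact ⟨U, V, h1, h2, h3, h4, h5, hzV⟩

theorem not_mem_cell {a b : Fin (m + 3)} (hab : a ≠ b) {p : D m} (hp : p ≠ E0) :
    c a p ∉ range (c b) := by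
  rintro ⟨z, hz⟩
  rcases c_eq.1 hz with h | h
  · exact hab h.1.symm
  · exact hp h.2

theorem sep01 (u : List (Fin (m + 3))) : Sep (pt u) E0 E1 → ∀ a ∈ u, a = 0 ∨ a = 1 := by
  induction u with
  | nil => intro _ a ha; simp at ha
  | cons b u ih =>
    intro h
    change Sep (c b (pt u)) E0 E1 at h
    have hp : pt u ≠ E0 := (br_pt u).ne.1
    have key : (b = 0 ∨ b = 1) ∧ Sep (pt u) E0 E1 := by
      by_cases hb : b = 0
      · subst hb
        refine ⟨Or.inl rfl, ?_⟩
        have h2 : Sep (c 0 (pt u)) E0 rt := h.step (preconn_range (c_cont 1))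
          (not_mem_cell one_ne_zero'.symm hp) ⟨E1, c1E1⟩ ⟨E0, c_E0' 1⟩
        rw [← c0E1, ← c_E0' 0] at h2
        exact (Sep.of_cons h2).symm
      by_cases hb1 : b = 1
      · subst hb1
        refine ⟨Or.inr rfl, ?_⟩
        have h2 : Sep (c 1 (pt u)) E1 rt := h.symm.step (preconn_range (c_cont 0))
          (not_mem_cell one_ne_zero' hp) ⟨E1, c0E1⟩ ⟨E0, c_E0' 0⟩
        rw [← c_E0' 1] at h2
        have h3 : Sep (c 1 (pt u)) (c 1 E1) (c 1 E0) := by rw [c1E1]; exact h2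
        exact (Sep.of_cons h3).symm
      exfalso
      refine h.not_conn (preconn_cells {0, 1}) ?_ ?_ ?_
      · simp only [mem_iUnion, not_exists]
        rintro a ha
        rcases ha with rfl | rfl
        · exact not_mem_cell hb hp
        · exact not_mem_cell hb1 hp
      · simp only [mem_iUnion]; exact ⟨0, Or.inl rfl, E1, c0E1⟩
      · simp only [mem_iUnion]; exact ⟨1, Or.inr rfl, E1, c1E1⟩
    intro a ha
    rcases List.mem_cons.1 ha with rfl | ha
    · exact key.1
    · exact ih key.2 a ha

/-! ### Density -/

theorem exists_perm {h : H m} (hr : h rt = rt) :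
    ∃ π : Equiv.Perm (Fin (m + 3)), ∀ a, h '' Ub a = Ub (π a) := by
  have hc := comps_image h rt
  rw [hr, comps_rt] at hc
  have : ∀ a, ∃ b, h '' Ub a = Ub b := by
    intro a
    have : h '' Ub a ∈ range (Ub : Fin (m + 3) → Set (D m)) := by
      rw [hc]; exact ⟨_, ⟨a, rfl⟩, rfl⟩
    obtain ⟨b, hb⟩ := this
    exact ⟨b, hb.symm⟩
  choose F hF using this
  have hi : Function.Injective F := by
    intro a b hab
    apply Ub_inj
    apply h.injective.image_injective
    rw [hF, hF, hab]
  exact ⟨Equiv.ofBijective F (Finite.injective_iff_bijective.1 hi), hF⟩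

theorem rt_of_Ub {h : H m} (hU : ∀ a, h '' Ub a = Ub a) : h rt = rt := by
  by_contra hne
  obtain ⟨a, ha⟩ := mem_Ub_of_ne hne
  rw [← hU a] at ha
  obtain ⟨z, hz, hzr⟩ := ha
  exact rt_not_mem_Ub (h.injective hzr ▸ hz)

theorem cell_of_Ub {h : H m} (hU : ∀ a, h '' Ub a = Ub a) (a : Fin (m + 3)) (z : D m) :
    ∃ z', h (c a z) = c a z' := by
  by_cases hz : z = E0
  · exact ⟨E0, by rw [hz, c_E0', rt_of_Ub hU]⟩
  · have : h (c a z) ∈ Ub a := by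
      rw [← hU a]; exact ⟨_, c_mem_Ub.2 ⟨rfl, hz⟩, rfl⟩
    obtain ⟨z', -, h'⟩ := this
    exact ⟨z', h'.symm⟩

theorem exists_restr {h : H m} (hU : ∀ a, h '' Ub a = Ub a) (a : Fin (m + 3)) :
    ∃ f : H m, f E0 = E0 ∧ ∀ z, h (c a z) = c a (f z) := by
  have hU' : ∀ a, (h⁻¹ : H m) '' Ub a = Ub a := by
    intro a
    conv_lhs => rw [← hU a]
    rw [image_image]
    simp
  choose F hF using cell_of_Ub hU a
  choose F' hF' using cell_of_Ub hU' a
  have emb : IsClosedEmbedding (c a : D m → D m) := (c_cont a).isClosedEmbedding (c_inj a)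
  have hFc : Continuous F := by
    rw [emb.isInducing.continuous_iff]
    have : c a ∘ F = h ∘ c a := by funext z; exact (hF z).symm
    rw [this]
    exact h.continuous.comp (c_cont a)
  have hFc' : Continuous F' := by
    rw [emb.isInducing.continuous_iff]
    have : c a ∘ F' = (h⁻¹ : H m) ∘ c a := by funext z; exact (hF' z).symm
    rw [this]
    exact (h⁻¹ : H m).continuous.comp (c_cont a)
  refine ⟨mkH F F' hFc hFc' ?_ ?_, ?_, hF⟩
  · intro z
    apply c_inj a
    rw [← hF', ← hF, inv_ap]
  · intro z
    apply c_inj a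
    rw [← hF, ← hF', ap_inv]
  · show F E0 = E0
    rw [← c_eq_rt (a := a), ← hF, c_E0', rt_of_Ub hU]

def Cl (k : ℕ) (h g : H m) : Prop :=
  ∀ w : List (Fin (m + 3)), w.length = k → ∀ z, ∃ z', g (cw w z) = h (cw w z')

theorem Cl.mul {k : ℕ} {h g r : H m} (hc : Cl k (r * h) g) : Cl k h (r⁻¹ * g) := by
  intro w hw z
  obtain ⟨z', hz⟩ := hc w hw z
  refine ⟨z', ?_⟩
  rw [mul_ap]
  apply inv_eq
  rw [hz]; rfl

theorem step {Γ : Subgroup (H m)} {k : ℕ} {h : H m} (hU : ∀ a, h '' Ub a = Ub a)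
    (IH : ∀ a (f : H m), f E0 = E0 → (∀ z, h (c a z) = c a (f z)) →
      ∃ g, ∃ hg : g E0 = E0, loc a g hg ∈ Γ ∧ Cl k f g) : ∃ ψ ∈ Γ, Cl (k + 1) h ψ := by
  choose f hf0 hf using exists_restr hU
  choose g hg hgΓ hgC using fun a => IH a (f a) (hf0 a) (hf a)
  have : ∀ s : Finset (Fin (m + 3)), ∃ ψ ∈ Γ, ∀ a z, ψ (c a z) = c a (if a ∈ s then g a z else z) := by
    intro s
    induction s using Finset.induction_on with
    | empty => exact ⟨1, one_mem _, fun a z => by simp⟩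
    | insert b s hb ih =>
      obtain ⟨ψ, hψ, hψc⟩ := ih
      refine ⟨loc b (g b) (hg b) * ψ, mul_mem (hgΓ b) hψ, fun a z => ?_⟩
      rw [mul_ap, hψc]
      by_cases hab : a = b
      · subst hab
        simp [hb]
      · rw [loc_ne hab]
        simp [hab]
  obtain ⟨ψ, hψ, hψc⟩ := this Finset.univ
  refine ⟨ψ, hψ, ?_⟩
  intro w hw z
  cases w with
  | nil => simp at hw
  | cons a w =>
    obtain ⟨z', hz⟩ := hgC a w (by simpa using hw) z
    refine ⟨z', ?_⟩
    show ψ (c a (cw w z)) = h (c a (cw w z'))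
    rw [hψc, hf, if_pos (Finset.mem_univ _), hz]

theorem finish {Γ : Subgroup (H m)} {k : ℕ} {h : H m} (P : H m → Prop) (hP : P h)
    (hPΓ : ∀ g ∈ Γ, ∀ f, P f → P (g * f))
    (hrt : ∃ g ∈ Γ, g (h rt) = rt)
    (hsg : ∀ (f : H m) (π : Equiv.Perm (Fin (m + 3))), P f → (∀ a, f '' Ub a = Ub (π a)) → sg π ∈ Γ)
    (hst : ∀ f : H m, P f → (∀ a, f '' Ub a = Ub a) → ∃ ψ ∈ Γ, Cl k f ψ) :
    ∃ ψ ∈ Γ, Cl k h ψ := by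
  obtain ⟨g, hg, hgr⟩ := hrt
  have h1 : P (g * h) := hPΓ _ hg _ hP
  obtain ⟨π, hπ⟩ := exists_perm (h := g * h) hgr
  have h2 := hsg _ π h1 hπ
  obtain ⟨ψ, hψ, hC⟩ := hst ((sg π)⁻¹ * (g * h)) (hPΓ _ (inv_mem h2) _ h1) (by
    intro a
    have : ((sg π)⁻¹ * (g * h) : H m) '' Ub a = ((sg π)⁻¹ : H m) '' ((g * h) '' Ub a) := by
      rw [image_image]; rfl
    rw [this, hπ, ← sg_Ub, image_image]
    simp)
  exact ⟨_, mul_mem (inv_mem hg) (mul_mem (inv_mem (inv_mem h2)) hψ), hC.mul.mul⟩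

theorem E0_mem : (E0 : D m) ∈ Ub 0 := by
  rw [← c0E1]; exact Ub_nonempty 0
theorem E1_mem : (E1 : D m) ∈ Ub 1 := by
  have := Ub_nonempty (1 : Fin (m + 3))
  rwa [c1E1] at this

theorem perm_fix {f : H m} {π : Equiv.Perm (Fin (m + 3))} (h : ∀ a, f '' Ub a = Ub (π a))
    {x : D m} (hx : f x = x) {a : Fin (m + 3)} (ha : x ∈ Ub a) : π a = a := by
  have : x ∈ Ub (π a) := by rw [← h]; exact ⟨x, ha, hx⟩
  exact Ub_disj this ha

theorem restr0 {h f : H m} (h0 : h E0 = E0) (hf : ∀ z, h (c 0 z) = c 0 (f z)) : f E1 = E1 := by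
  apply c_inj 0
  rw [← hf, c0E1, h0]
theorem restr1 {h f : H m} (h0 : h E1 = E1) (hf : ∀ z, h (c 1 z) = c 1 (f z)) : f E1 = E1 := by
  apply c_inj 1
  rw [← hf, c1E1, h0]

theorem dens12 (k : ℕ) : (∀ h : H m, h E0 = E0 → ∃ g ∈ Γ1 m, Cl k h g) ∧
    (∀ h : H m, h E0 = E0 ∧ h E1 = E1 → ∃ g ∈ Γ2 m, Cl k h g) := by
  induction k with
  | zero =>
    have : ∀ h : H m, Cl 0 h 1 := by
      intro h w hw z
      rw [List.length_eq_zero_iff] at hw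
      subst hw
      exact ⟨h⁻¹ z, (ap_inv h z).symm⟩
    exact ⟨fun h _ => ⟨1, one_mem _, this h⟩, fun h _ => ⟨1, one_mem _, this h⟩⟩
  | succ k ih =>
    constructor
    · intro h hh
      refine finish (fun f => f E0 = E0) hh ?_ (Γ1_trans (br_image h Br.root)) ?_ ?_
      · intro g hg f hf
        rw [mul_ap, hf, hg.2]
      · intro f π hf hπ
        exact sg_Γ1 (perm_fix hπ hf E0_mem)
      · intro f hf hU
        refine step hU ?_
        intro a r hr0 hr
        by_cases ha : a = 0
        · subst ha
          obtain ⟨g, hg, hC⟩ := ih.2 r ⟨hr0, restr0 hf hr⟩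
          exact ⟨g, hg.2.1, loc_Γ1_0 hg, hC⟩
        · obtain ⟨g, hg, hC⟩ := ih.1 r hr0
          exact ⟨g, hg.2, loc_Γ1_ne hg ha, hC⟩
    · intro h hh
      refine finish (fun f => f E0 = E0 ∧ f E1 = E1) hh ?_ ?_ ?_ ?_
      · intro g hg f hf
        rw [mul_ap, mul_ap, hf.1, hf.2]
        exact hg.2
      · obtain ⟨w, hw⟩ := (br_image h Br.root).pt
        rw [hw]
        apply Γ2_trans
        apply sep01
        have := sep_E0_E1.map h
        rwa [hh.1, hh.2, hw] at this
      · intro f π hf hπ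
        exact sg_Γ2 (perm_fix hπ hf.1 E0_mem) (perm_fix hπ hf.2 E1_mem)
      · intro f hf hU
        refine step hU ?_
        intro a r hr0 hr
        by_cases ha : a = 0
        · subst ha
          obtain ⟨g, hg, hC⟩ := ih.2 r ⟨hr0, restr0 hf.1 hr⟩
          exact ⟨g, hg.2.1, loc_Γ2_0 hg, hC⟩
        by_cases ha1 : a = 1
        · subst ha1
          obtain ⟨g, hg, hC⟩ := ih.2 r ⟨hr0, restr1 hf.2 hr⟩
          exact ⟨g, hg.2.1, loc_Γ2_1 hg, hC⟩
        · obtain ⟨g, hg, hC⟩ := ih.1 r hr0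
          exact ⟨g, hg.2, loc_Γ2_ne hg ha ha1, hC⟩

theorem loc_G {g : H m} (h : g ∈ Γ1 m) (a : Fin (m + 3)) : loc a g h.2 ∈ G m := by
  obtain ⟨φ, hφ, hE⟩ := lift_c h.1 a
  have : φ = loc a g h.2 := by
    apply Homeomorph.ext
    intro x
    obtain ⟨b, z, rfl⟩ := exists_c x
    by_cases hx : c b z ∈ range (c a)
    · obtain ⟨y, hy⟩ := hx
      rw [← hy, hE.1, loc_same]
    · rw [hE.2 _ hx, (ext_loc a g h.2).2 _ hx]
  rwa [← this]

theorem dens0 (k : ℕ) (h : H m) : ∃ g ∈ G m, Cl (k + 1) h g := by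
  refine finish (fun _ => True) trivial (fun _ _ _ _ => trivial) (G_trans (br_image h Br.root))
    (fun _ π _ _ => sg_mem π) ?_
  intro f _ hU
  refine step hU ?_
  intro a r hr0 hr
  obtain ⟨g, hg, hC⟩ := (dens12 k).1 r hr0
  exact ⟨g, hg.2, loc_G hg a, hC⟩

theorem G_dense : Dense (G m : Set (H m)) := by
  intro h
  choose g hg hC using fun k => dens0 k h
  refine mem_closure_of_tendsto (f := g) (b := atTop) ?_ (Eventually.of_forall hg)
  rw [nhds_induced, tendsto_comap_iff, ContinuousMap.tendsto_nhds_compactOpen]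
  intro K hK U hU hKU
  obtain ⟨k0, hk0⟩ := lebesgue (hU.preimage h.continuous) hK.isClosed.isOpen_compl (by
    ext x
    by_cases hx : x ∈ K
    · simp only [mem_union, mem_univ, iff_true]; exact Or.inl (hKU hx)
    · simp only [mem_union, mem_univ, iff_true]; exact Or.inr hx)
  filter_upwards [eventually_ge_atTop k0] with k hk x hx
  obtain ⟨w, hw, y, rfl⟩ := exists_cw (k + 1) x
  obtain ⟨z, hz⟩ := hC k w hw y
  show g k (cw w y) ∈ U
  rw [hz]
  rcases hk0 w (by omega) with h1 | h1
  · exact h1 z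
  · exact absurd hx (h1 y)

/-! ### Circles and arcs -/

theorem circle_compl (u : Circle) : IsPreconnected ({u}ᶜ : Set Circle) := by
  obtain ⟨θ, rfl⟩ : ∃ θ : ℝ, Circle.exp θ = u := ⟨_, Circle.exp_arg u⟩
  have : ({Circle.exp θ}ᶜ : Set Circle) = Circle.exp '' Ioo θ (θ + 2 * Real.pi) := by
    ext z
    constructor
    · intro hz
      obtain ⟨y, hy, hzy⟩ := Circle.periodic_exp.exists_mem_Ico Real.two_pi_pos (Complex.arg z) θ
      rw [Circle.exp_arg] at hzy
      refine ⟨y, ⟨lt_of_le_of_ne hy.1 ?_, hy.2⟩, hzy.symm⟩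
      rintro rfl
      exact hz hzy
    · rintro ⟨y, hy, rfl⟩ h
      have h' : Circle.exp y = Circle.exp θ := h
      rw [Circle.exp_eq_exp] at h'
      obtain ⟨k, hk⟩ := h'
      have hpi := Real.two_pi_pos
      have h1 : (0 : ℝ) < k * (2 * Real.pi) := by linarith [hy.1]
      have h2 : (k : ℝ) * (2 * Real.pi) < 1 * (2 * Real.pi) := by linarith [hy.2]
      have h3 : (0 : ℝ) < k := by
        by_contra hn
        have := mul_nonpos_of_nonpos_of_nonneg (not_lt.1 hn) hpi.le
        linarith
      have h4 : (k : ℝ) < 1 := lt_of_mul_lt_mul_right h2 hpi.le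
      have h5 : (0 : ℤ) < k := by exact_mod_cast h3
      have h6 : k < (1 : ℤ) := by exact_mod_cast h4
      omega
  rw [this]
  exact isPreconnected_Ioo.image _ Circle.exp.continuous.continuousOn

theorem no_circle (S : Set (D m)) : IsEmpty (S ≃ₜ Circle) := by
  refine ⟨fun e => ?_⟩
  set f : Circle → D m := fun z => (e.symm z : D m) with hf
  have fc : Continuous f := continuous_subtype_val.comp e.symm.continuous
  have fi : Function.Injective f := Subtype.val_injective.comp e.symm.injective
  have hne : (1 : Circle) ≠ Circle.exp Real.pi := by
    intro h
    have := congrArg (fun z : Circle => (z : ℂ)) h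
    simp [Circle.coe_exp] at this
    norm_num at this
  obtain ⟨p, -, hp⟩ := exists_sep (fi.ne hne)
  have hpU : ∀ z, Sep p z z → False := by
    rintro z ⟨U, V, -, -, h3, -, h5, h6⟩
    exact disjoint_left.1 h3 h5 h6
  have hmem : ∀ {x y : D m}, Sep p x y → x ≠ p := by
    rintro x y ⟨U, V, -, -, h3, h4, h5, h6⟩ rfl
    have : x ∈ U ∪ V := Or.inl h5
    rw [h4] at this
    exact this rfl
  by_cases hpS : ∃ u, f u = p
  · obtain ⟨u, rfl⟩ := hpS
    refine hp.not_conn ((circle_compl u).image f fc.continuousOn) ?_ ⟨1, ?_, rfl⟩ ⟨_, ?_, rfl⟩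
    · rintro ⟨z, hz, hzu⟩
      exact hz (fi hzu)
    · intro h
      have h' : 1 = u := h
      exact hmem hp (by rw [h'])
    · intro h
      have h' : Circle.exp Real.pi = u := h
      exact hmem hp.symm (by rw [h'])
  · have hpre : IsPreconnected (range f) := by
      have : range f = f '' (Circle.exp '' univ) := by
        rw [image_image, image_univ]
        ext x
        constructor
        · rintro ⟨z, rfl⟩
          exact ⟨Complex.arg z, congrArg f (Circle.exp_arg z)⟩
        · rintro ⟨t, rfl⟩; exact ⟨_, rfl⟩
      rw [this]
      exact (isPreconnected_univ.image _ Circle.exp.continuous.continuousOn).image _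
        fc.continuousOn
    exact hp.not_conn hpre (fun h => hpS h) ⟨_, rfl⟩ ⟨_, rfl⟩

theorem arc_br (A : Set (D m)) (h : Nonempty (A ≃ₜ unitInterval)) : ∃ p ∈ A, Br p := by
  obtain ⟨e⟩ := h
  have hA : IsPreconnected A := by
    have : A = range (fun t : unitInterval => (e.symm t : D m)) := by
      ext x
      constructor
      · intro hx; exact ⟨e ⟨x, hx⟩, by simp⟩
      · rintro ⟨t, rfl⟩; exact (e.symm t).2
    rw [this]
    exact isPreconnected_range (continuous_subtype_val.comp e.symm.continuous)
  have hne : (e.symm 0 : D m) ≠ e.symm 1 := by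
    intro h
    have := e.symm.injective (Subtype.ext h)
    exact zero_ne_one this
  obtain ⟨p, hB, hp⟩ := exists_sep hne
  refine ⟨p, ?_, hB⟩
  by_contra hpA
  exact hp.not_conn hA hpA (e.symm 0).2 (e.symm 1).2

theorem isWaz : IsWazewskiDendrite (m + 3) (D m) := by
  refine ⟨⟨inferInstance, inferInstance, inferInstance, inferInstance, inferInstance, no_circle⟩,
    ?_, ?_⟩
  · intro p
    by_cases hp : Br p
    · exact Or.inr (Or.inr (order_iff.2 hp))
    · rcases order_le_two hp with h | h
      · exact Or.inl h
      · exact Or.inr (Or.inl h)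
  · intro A hA
    obtain ⟨p, hpA, hp⟩ := arc_br A hA
    exact ⟨p, hpA, order_iff.2 hp⟩

end Waz

theorem statement12 (n : ℕ) (hn : 3 ≤ n) :
    ∃ (X : Type) (_ : TopologicalSpace X) (_ : IsWazewskiDendrite n X)
      (G : Subgroup (X ≃ₜ X)),
      G.FG ∧ Dense (G : Set (X ≃ₜ X)) ∧
      (∀ p q : X, ptOrder X p = n → ptOrder X q = n →
        ∃ h ∈ (⁅G, G⁆ : Subgroup (X ≃ₜ X)), (h : X ≃ₜ X) p = q) ∧
      ∀ p q : X, ptOrder X p = n → ptOrder X q = n →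
        ∀ B ∈ setComponents X {p}ᶜ, ∀ B' ∈ setComponents X {q}ᶜ,
          ∃ h ∈ (⁅G, G⁆ : Subgroup (X ≃ₜ X)), (h : X ≃ₜ X) '' B = B' := by
  obtain ⟨m, rfl⟩ : ∃ m, n = m + 3 := ⟨n - 3, by omega⟩
  refine ⟨Waz.D m, inferInstance, Waz.isWaz, Waz.G m, Waz.G_fg, Waz.G_dense, ?_, ?_⟩
  · intro p q hp hq
    exact Waz.N_trans (Waz.order_iff.1 hp) (Waz.order_iff.1 hq)
  · intro p q hp hq B hB B' hB'
    exact Waz.N_branch (Waz.order_iff.1 hp) (Waz.order_iff.1 hq) hB hB'
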